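/- arXiv:1707.08896 — 4 statements merged into one kernel-verified Lean document; each statement's English description precedes it below -/
import Mathlib

section
/- Let (A, ∗) be a finite-dimensional real left-symmetric algebra with characteristic polynomial P(x) = det(id_A + R(x)) and trace form τ. The following are equivalent: (i) R(a) is nilpotent for every a ∈ A; (ii) tr R(a) = 0 for every a ∈ A; (iii) τ(x,y) = 0 for all x, y ∈ A; (iv) there is N ≥ 1 such that the iterated Fréchet derivative of order N+1 of the function x ↦ log P(x) at the point 0 vanishes; (v) P(x) = 1 for all x ∈ A; (vi) the derivative of P at 0 is the zero linear functional; (vii) P(x) ≠ 0 for all x ∈ A. -/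
def IsLSA {A : Type*} [AddCommGroup A] [Module ℝ A]
    (mul : A →ₗ[ℝ] A →ₗ[ℝ] A) : Prop :=
  ∀ x y z : A,
    mul (mul x y) z - mul x (mul y z) = mul (mul y x) z - mul y (mul x z)

open Polynomial Matrix Filter Topology

open scoped Matrix.Norms.Operator

theorem Module.End.isNilpotent_of_trace_pow_eq_zero {K V : Type*} [Field K] [CharZero K]
    [AddCommGroup V] [Module K V] [FiniteDimensional K V] (f : Module.End K V) (k : ℕ)
    (h : ∀ m, k ≤ m → LinearMap.trace K V (f ^ m) = 0) : IsNilpotent f := by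
  obtain ⟨q, hq, hdvd⟩ := exists_eq_pow_rootMultiplicity_mul_and_not_dvd f.charpoly
    f.charpoly_monic.ne_zero 0
  set r := rootMultiplicity 0 f.charpoly
  rw [C_0, sub_zero] at hq hdvd
  obtain ⟨u, v, huv⟩ : IsCoprime (X ^ (r + k) : K[X]) q :=
    ((irreducible_X.coprime_iff_not_dvd).2 hdvd).pow_left
  have hann : aeval f (X ^ (r + k) * q) = 0 := by
    rw [pow_add, mul_right_comm, ← hq, map_mul, LinearMap.aeval_self_charpoly, zero_mul]
  have hidem : IsIdempotentElem (aeval f (u * X ^ (r + k))) := by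
    have e : u * X ^ (r + k) * (u * X ^ (r + k)) =
        u * X ^ (r + k) - u * v * (X ^ (r + k) * q) := by
      linear_combination (u * X ^ (r + k)) * huv
    rw [IsIdempotentElem, ← map_mul, e, map_sub, map_mul _ (u * v), hann, mul_zero, sub_zero]
  have htr : LinearMap.trace K V (aeval f (u * X ^ (r + k))) = 0 := by
    rw [map_mul, aeval_eq_sum_range, Finset.sum_mul, map_sum]
    refine Finset.sum_eq_zero fun i _ => ?_
    rw [smul_mul_assoc, map_pow, aeval_X, ← pow_add, map_smul, h _ (by omega), smul_zero]
  have hzero : aeval f (u * X ^ (r + k)) = 0 :=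
    LinearMap.IsIdempotentElem.eq_zero_of_trace_eq_zero hidem htr
  refine ⟨r + k, ?_⟩
  have e : (X : K[X]) ^ (r + k) =
      u * X ^ (r + k) * X ^ (r + k) + v * (X ^ (r + k) * q) := by
    linear_combination (-X ^ (r + k)) * huv
  have := congrArg (aeval f) e
  rwa [map_add, map_mul, map_mul _ v, hzero, hann, zero_mul, mul_zero, add_zero, map_pow,
    aeval_X] at this

theorem hasDerivAt_const_add_smul {E : Type*} [NormedAddCommGroup E] [NormedSpace ℝ E]
    (c v : E) (t : ℝ) : HasDerivAt (fun s : ℝ => c + s • v) v t := by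
  simpa using! ((hasDerivAt_id t).smul_const v).const_add c

theorem HasDerivAt.matrix_trace {n : Type*} [Fintype n] {γ : ℝ → Matrix n n ℝ} {γ' : Matrix n n ℝ} {t : ℝ}
    (hγ : HasDerivAt γ γ' t) : HasDerivAt (fun s => (γ s).trace) γ'.trace t :=
  (LinearMap.toContinuousLinearMap (traceLinearMap n ℝ ℝ)).hasFDerivAt.comp_hasDerivAt t hγ

section Jacobi

variable {n : Type*} [Fintype n] [DecidableEq n]

theorem Matrix.contDiff_det : ContDiff ℝ ⊤ (det : Matrix n n ℝ → ℝ) := by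
  have : (det : Matrix n n ℝ → ℝ) = fun M => ∑ σ : Equiv.Perm n, σ.sign • ∏ i, M (σ i) i := by
    ext M; exact det_apply M
  rw [this]
  have h : ∀ i j, ContDiff ℝ ⊤ fun M : Matrix n n ℝ => M i j := fun i j =>
    (LinearMap.toContinuousLinearMap (Matrix.entryLinearMap ℝ ℝ i j)).contDiff
  simp only [Units.smul_def, ← Int.cast_smul_eq_zsmul ℝ]
  exact ContDiff.sum fun σ _ => (contDiff_prod fun i _ => h (σ i) i).const_smul _

theorem Matrix.hasDerivAt_det_one_add_smul (M : Matrix n n ℝ) :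
    HasDerivAt (fun t : ℝ => det (1 + t • M)) M.trace 0 := by
  have e : (fun t : ℝ => det (1 + t • M)) =
      fun t => (det (1 + (X : ℝ[X]) • M.map C)).eval t := by
    ext t
    rw [← coe_evalRingHom, RingHom.map_det]
    congr 1
    ext i j
    simp [Matrix.one_apply, apply_ite, mul_comm t]
  rw [e, ← derivative_det_one_add_X_smul]
  exact Polynomial.hasDerivAt _ _

theorem Matrix.hasFDerivAt_det_one :
    HasFDerivAt (det : Matrix n n ℝ → ℝ)
      (LinearMap.toContinuousLinearMap (traceLinearMap n ℝ ℝ)) 1 := by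
  have h := (contDiff_det (n := n).differentiable (by simp) 1).hasFDerivAt
  refine h.congr_fderiv (ContinuousLinearMap.ext fun M => ?_)
  have hline := hasDerivAt_const_add_smul (1 : Matrix n n ℝ) M 0
  have h' : HasFDerivAt (det : Matrix n n ℝ → ℝ) (fderiv ℝ det 1)
      ((1 : Matrix n n ℝ) + (0 : ℝ) • M) := by
    rw [zero_smul, add_zero]; exact h
  have h2 := h'.comp_hasDerivAt (0 : ℝ) hline
  exact h2.unique (hasDerivAt_det_one_add_smul M)

/-- Jacobi's formula at an invertible matrix. -/
theorem HasDerivAt.matrix_det {γ : ℝ → Matrix n n ℝ} {γ' : Matrix n n ℝ} {t : ℝ}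
    (hγ : HasDerivAt γ γ' t) (ht : IsUnit (γ t).det) :
    HasDerivAt (fun s => (γ s).det) ((γ t).det * ((γ t)⁻¹ * γ').trace) t := by
  have e : (fun s => (γ s).det) = fun s => (γ t).det * ((γ t)⁻¹ * γ s).det := by
    ext s
    rw [det_mul, ← mul_assoc, ← det_mul, mul_nonsing_inv _ ht, det_one, one_mul]
  rw [e]
  have h1 : HasFDerivAt (det : Matrix n n ℝ → ℝ)
      (LinearMap.toContinuousLinearMap (traceLinearMap n ℝ ℝ)) ((γ t)⁻¹ * γ t) := by
    rw [nonsing_inv_mul _ ht]; exact hasFDerivAt_det_one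
  exact (h1.comp_hasDerivAt t (hγ.const_mul ((γ t)⁻¹))).const_mul _

theorem Matrix.hasDerivAt_mul_inv_one_add_smul (M : Matrix n n ℝ) {t : ℝ}
    (ht : IsUnit (1 + t • M).det) :
    HasDerivAt (fun s : ℝ => M * (1 + s • M)⁻¹) (-(M * (1 + t • M)⁻¹) ^ 2) t := by
  have hline := hasDerivAt_const_add_smul (1 : Matrix n n ℝ) M t
  obtain ⟨u, hu⟩ := (isUnit_iff_isUnit_det _).2 ht
  have h1 := hasFDerivAt_ringInverse (𝕜 := ℝ) u
  rw [hu] at h1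
  have h2 := (h1.comp_hasDerivAt t hline).const_mul M
  have e : (fun s : ℝ => M * (1 + s • M)⁻¹) = fun s => M * Ring.inverse (1 + s • M) := by
    simp only [nonsing_inv_eq_ringInverse]
  rw [e]
  refine HasDerivAt.congr_deriv h2 ?_
  have : (↑u⁻¹ : Matrix n n ℝ) = (1 + t • M)⁻¹ := by rw [← hu, coe_units_inv]
  simp [this, pow_two, mul_assoc]

theorem hasDerivAt_pow_of_riccati {𝔸 : Type*} [NormedRing 𝔸] [NormedAlgebra ℝ 𝔸] {u : ℝ → 𝔸}
    {t : ℝ} (hu : HasDerivAt u (-u t ^ 2) t) (k : ℕ) :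
    HasDerivAt (fun s => u s ^ k) (-(k : ℝ) • u t ^ (k + 1)) t := by
  induction k with
  | zero => simpa using hasDerivAt_const t (1 : 𝔸)
  | succ k ih =>
    have h := ih.mul hu
    simp only [Pi.mul_def, ← pow_succ] at h
    convert h using 1
    rw [smul_mul_assoc, mul_neg, ← pow_succ, ← pow_add]
    push_cast
    module

theorem Matrix.eventually_isUnit_det_one_add_smul (M : Matrix n n ℝ) :
    ∀ᶠ t : ℝ in 𝓝 0, IsUnit (1 + t • M).det := by
  have hc : Continuous fun t : ℝ => (1 + t • M).det := by fun_prop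
  have := hc.continuousAt.eventually_ne (x := 0) (y := 0) (by simp)
  exact this.mono fun t ht => ht.isUnit

theorem Matrix.iteratedDeriv_log_det_one_add_smul (M : Matrix n n ℝ) (k : ℕ) :
    iteratedDeriv (k + 1) (fun t : ℝ => Real.log (1 + t • M).det) =ᶠ[𝓝 0]
      fun t => (-1) ^ k * (k.factorial : ℝ) * ((M * (1 + t • M)⁻¹) ^ (k + 1)).trace := by
  induction k with
  | zero =>
    filter_upwards [eventually_isUnit_det_one_add_smul M] with t ht
    have hline := hasDerivAt_const_add_smul (1 : Matrix n n ℝ) M t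
    rw [zero_add, iteratedDeriv_one, ((hline.matrix_det ht).log ht.ne_zero).deriv,
      mul_div_cancel_left₀ _ ht.ne_zero, trace_mul_comm]
    simp
  | succ k ih =>
    rw [iteratedDeriv_succ]
    filter_upwards [ih.deriv, eventually_isUnit_det_one_add_smul M] with t h ht
    rw [h, (((hasDerivAt_pow_of_riccati (hasDerivAt_mul_inv_one_add_smul M ht)
      (k + 1)).matrix_trace).const_mul _).deriv, trace_smul, Nat.factorial_succ]
    push_cast
    rw [smul_eq_mul]
    ring

end Jacobi

section PolynomialCurves

variable {A n : Type*} [AddCommGroup A] [Module ℝ A] [Fintype n] [DecidableEq n]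

/-- The determinant of `1 + ρ` along a polynomial curve is a polynomial. -/
theorem exists_polynomial_eval_eq_det_one_add (ρ : A →ₗ[ℝ] Matrix n n ℝ) (a : ℕ → A) (m : ℕ) :
    ∃ Q : ℝ[X], ∀ t, Q.eval t = (1 + ρ (∑ k ∈ Finset.range m, t ^ k • a k)).det := by
  refine ⟨(1 + ∑ k ∈ Finset.range m, (X ^ k : ℝ[X]) • (ρ (a k)).map C).det, fun t => ?_⟩
  rw [← coe_evalRingHom, RingHom.map_det]
  congr 1
  ext i j
  simp [Matrix.one_apply, apply_ite, Matrix.sum_apply, eval_finsetSum]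
  exact Finset.sum_congr rfl fun _ _ => mul_comm _ _

theorem Polynomial.eq_zero_of_derivative_eq_C_mul {K : Type*} [Field K] [CharZero K] {Q : K[X]}
    {s : K} (hs : s ≠ 0) (h : derivative Q = C s * Q) : Q = 0 := by
  by_contra hQ
  have h1 := degree_derivative_lt hQ
  rw [h, degree_C_mul hs] at h1
  exact lt_irrefl _ h1

theorem LinearMap.exists_pow_apply_add_eq_zero [FiniteDimensional ℝ A] (f : Module.End ℝ A)
    (x : A) : ∃ m p, (f ^ m) (x + f p) = 0 := by
  obtain ⟨m, hm, hm1⟩ := (f.eventually_codisjoint_ker_pow_range_pow.and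
    (eventually_ge_atTop 1)).exists
  obtain ⟨y, hy, z, hz, rfl⟩ := Submodule.mem_sup.1
    ((codisjoint_iff.1 hm).symm ▸ Submodule.mem_top : x ∈ _)
  obtain ⟨w, rfl⟩ := hz
  obtain ⟨m, rfl⟩ := Nat.exists_eq_add_of_le' hm1
  refine ⟨m + 1, -(f ^ m) w, ?_⟩
  have : f ((f ^ m) w) = (f ^ (m + 1)) w := by rw [pow_succ']; rfl
  rw [map_neg, this, add_neg_cancel_right]
  exact hy

/-- An affine vector field `v ↦ x + f v` has a polynomial integral curve. -/
theorem LinearMap.exists_polynomial_integral_curve [FiniteDimensional ℝ A] (f : Module.End ℝ A)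
    (x : A) : ∃ (m : ℕ) (a : ℕ → A), ∀ t : ℝ,
      ∑ k ∈ Finset.range m, ((k : ℝ) * t ^ (k - 1)) • a k =
        x + f (∑ k ∈ Finset.range m, t ^ k • a k) := by
  obtain ⟨m, p, h⟩ := f.exists_pow_apply_add_eq_zero x
  let a : ℕ → A
    | 0 => p
    | k + 1 => ((k + 1).factorial : ℝ)⁻¹ • (f ^ k) (x + f p)
  refine ⟨m + 1, a, fun t => ?_⟩
  have ha : ∀ k, ((k + 1 + 1 : ℕ) : ℝ) • a (k + 1 + 1) = f (a (k + 1)) := by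
    intro k
    simp only [a, map_smul, smul_smul, pow_succ' f k, Module.End.mul_apply]
    congr 1
    rw [Nat.factorial_succ (k + 1)]
    push_cast
    have : ((k + 1).factorial : ℝ) ≠ 0 := by positivity
    field_simp
  have hm : f (a m) = if m = 0 then f p else 0 := by
    cases m with
    | zero => rfl
    | succ m =>
      simp only [a, map_smul, ← Module.End.mul_apply, ← pow_succ', h, smul_zero]
      simp
  rw [Finset.sum_range_succ', map_sum]
  simp only [Nat.cast_zero, zero_mul, zero_smul, add_zero, Nat.add_sub_cancel, map_smul]
  cases m with
  | zero =>
    have : x + f p = 0 := by simpa using h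
    simp [a, this]
  | succ m =>
    rw [Finset.sum_range_succ', Finset.sum_range_succ, Finset.sum_range_succ', hm]
    have e : ∀ k, (((k + 1 + 1 : ℕ) : ℝ) * t ^ (k + 1)) • a (k + 1 + 1) =
        t ^ (k + 1) • f (a (k + 1)) := by
      intro k
      rw [mul_comm, mul_smul, ha k]
    rw [Finset.sum_congr rfl fun k _ => e k]
    simp [a]
    abel

end PolynomialCurves

section LSA

variable {A : Type*} [AddCommGroup A] [Module ℝ A] {mul : A →ₗ[ℝ] A →ₗ[ℝ] A}

theorem IsLSA.flip_mul (h : IsLSA mul) (x v : A) :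
    (mul.flip (mul x v) : Module.End ℝ A) =
      mul.flip v * mul.flip x + mul x * mul.flip v - mul.flip v * mul x := by
  ext z
  have := h x z v
  simp only [LinearMap.flip_apply, LinearMap.sub_apply, LinearMap.add_apply,
    Module.End.mul_apply]
  rw [sub_eq_sub_iff_add_eq_add] at this
  rw [eq_sub_iff_add_eq, ← sub_eq_zero]
  rw [← sub_eq_zero] at this
  rw [← this]
  abel

theorem IsLSA.trace_flip_pow_mul (h : IsLSA mul) (k : ℕ) (y z : A) :
    LinearMap.trace ℝ A ((mul.flip z : Module.End ℝ A) ^ (k + 1) * mul.flip y) =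
      LinearMap.trace ℝ A ((mul.flip z : Module.End ℝ A) ^ k * mul.flip (mul y z)) := by
  have e := LinearMap.trace_mul_comm ℝ
    ((mul.flip z : Module.End ℝ A) ^ k * mul y) (mul.flip z : Module.End ℝ A)
  rw [← mul_assoc, ← pow_succ'] at e
  rw [h.flip_mul, mul_sub, mul_add, map_sub, map_add, ← mul_assoc, ← mul_assoc, ← mul_assoc,
    ← pow_succ, e]
  ring

theorem IsLSA.isNilpotent_flip [FiniteDimensional ℝ A] (h : IsLSA mul) (k : ℕ)
    (hk : ∀ y z : A,
      LinearMap.trace ℝ A ((mul.flip z : Module.End ℝ A) ^ k * mul.flip y) = 0) (z : A) :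
    IsNilpotent (mul.flip z : Module.End ℝ A) := by
  have key : ∀ j y, LinearMap.trace ℝ A
      ((mul.flip z : Module.End ℝ A) ^ (k + j) * mul.flip y) = 0 := by
    intro j
    induction j with
    | zero => exact fun y => hk y z
    | succ j ih => exact fun y => by rw [← add_assoc, h.trace_flip_pow_mul, ih]
  refine Module.End.isNilpotent_of_trace_pow_eq_zero _ (k + 1) fun m hm => ?_
  obtain ⟨j, rfl⟩ := Nat.exists_eq_add_of_le hm
  rw [add_right_comm, pow_succ]
  exact key j z

end LSA

theorem Matrix.trace_pow_mul_eq_zero {A n : Type*} [AddCommGroup A] [Module ℝ A] [Fintype n]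
    [DecidableEq n] (ρ : A →ₗ[ℝ] Matrix n n ℝ) (k : ℕ) (h : ∀ z, (ρ z ^ (k + 1)).trace = 0)
    (y z : A) : (ρ z ^ k * ρ y).trace = 0 := by
  have h1 := ((hasDerivAt_const_add_smul (ρ z) (ρ y) 0).fun_pow' (k + 1)).matrix_trace
  have e : (fun t : ℝ => ((ρ z + t • ρ y) ^ (k + 1)).trace) = fun _ => 0 := by
    ext t
    rw [← map_smul, ← map_add, h]
  rw [e] at h1
  have h2 := h1.unique (hasDerivAt_const (0 : ℝ) (0 : ℝ))
  rw [trace_sum, Finset.sum_congr rfl (g := fun _ => (ρ z ^ k * ρ y).trace)] at h2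
  · rw [Finset.sum_const, Finset.card_range, smul_eq_zero] at h2
    exact h2.resolve_left (Nat.succ_ne_zero k)
  · intro i hi
    rw [trace_mul_comm, ← mul_assoc, zero_smul, add_zero, ← pow_add, Nat.pred_succ,
      Nat.add_sub_cancel' (Nat.lt_succ_iff.1 (Finset.mem_range.1 hi))]

theorem trace_pow_eq_zero_of_iteratedFDeriv_log {A n : Type*} [NormedAddCommGroup A]
    [NormedSpace ℝ A] [FiniteDimensional ℝ A] [Fintype n] [DecidableEq n]
    (ρ : A →ₗ[ℝ] Matrix n n ℝ) (k : ℕ)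
    (h : iteratedFDeriv ℝ (k + 1) (fun x => Real.log (1 + ρ x).det) 0 = 0) (z : A) :
    (ρ z ^ (k + 1)).trace = 0 := by
  let s : Set A := {x | (1 + ρ x).det ≠ 0}
  let g : ℝ →L[ℝ] A := ContinuousLinearMap.toSpanSingleton ℝ z
  have hP : ContDiff ℝ ⊤ fun x => (1 + ρ x).det :=
    contDiff_det.comp (contDiff_const.add (LinearMap.toContinuousLinearMap ρ).contDiff)
  have hs : IsOpen s := isOpen_ne_fun hP.continuous continuous_const
  have hgs : IsOpen (g ⁻¹' s) := hs.preimage g.continuous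
  have h0 : g 0 ∈ s := by simp [s]
  have hlog : ContDiffOn ℝ ⊤ (fun x => Real.log (1 + ρ x).det) s :=
    hP.contDiffOn.log fun x hx => hx
  have h1 := g.iteratedFDerivWithin_comp_right hlog hs.uniqueDiffOn hgs.uniqueDiffOn h0
    (i := k + 1) le_top
  rw [iteratedFDerivWithin_of_isOpen _ hgs (show (0 : ℝ) ∈ g ⁻¹' s from h0),
    iteratedFDerivWithin_of_isOpen _ hs h0, map_zero, h] at h1
  have h2 := (iteratedDeriv_log_det_one_add_smul (ρ z) k).self_of_nhds
  have e : (fun t : ℝ => Real.log (1 + t • ρ z).det) =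
      (fun x => Real.log (1 + ρ x).det) ∘ g := by
    ext t
    simp [g]
  rw [e, iteratedDeriv_eq_iteratedFDeriv, h1] at h2
  have h3 : (k.factorial : ℝ) ≠ 0 := by positivity
  simpa [h3] using h2

theorem IsLSA.trace_eq_zero_of_det_ne_zero {A n : Type*} [NormedAddCommGroup A]
    [NormedSpace ℝ A] [FiniteDimensional ℝ A] [Fintype n] [DecidableEq n]
    (mul : A →ₗ[ℝ] A →ₗ[ℝ] A) (ρ : A →ₗ[ℝ] Matrix n n ℝ) (l : A → Matrix n n ℝ)
    (h : ∀ x v, ρ (mul x v) = ρ v * ρ x + l x * ρ v - ρ v * l x)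
    (hP : ∀ x, (1 + ρ x).det ≠ 0) (x : A) : (ρ x).trace = 0 := by
  obtain ⟨m, a, ha⟩ := LinearMap.exists_polynomial_integral_curve (mul x) x
  obtain ⟨Q, hQ⟩ := exists_polynomial_eval_eq_det_one_add ρ a m
  by_contra hx
  suffices derivative Q = C (ρ x).trace * Q by
    have h0 := hQ 0
    rw [Polynomial.eq_zero_of_derivative_eq_C_mul hx this, eval_zero] at h0
    exact hP _ h0.symm
  refine Polynomial.funext fun t => ?_
  set v : ℝ → A := fun t => ∑ k ∈ Finset.range m, t ^ k • a k with hv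
  have hvd : HasDerivAt v (x + mul x (v t)) t := by
    rw [← ha]
    exact HasDerivAt.fun_sum fun k _ => (hasDerivAt_pow k t).smul_const (a k)
  have hγ : HasDerivAt (fun t => 1 + ρ (v t)) (ρ (x + mul x (v t))) t :=
    ((LinearMap.toContinuousLinearMap ρ).hasFDerivAt.comp_hasDerivAt t hvd).const_add 1
  have hu : IsUnit (1 + ρ (v t)).det := (hP _).isUnit
  have hd := hγ.matrix_det hu
  have e : (fun t => (1 + ρ (v t)).det) = fun t => Q.eval t := by
    ext t; exact (hQ t).symm
  rw [e] at hd
  rw [(Polynomial.hasDerivAt Q t).unique hd, eval_mul, eval_C, hQ t, mul_comm]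
  congr 1
  have hM : ρ (x + mul x (v t)) =
      (1 + ρ (v t)) * ρ x + (l x * (1 + ρ (v t)) - (1 + ρ (v t)) * l x) := by
    rw [map_add, h]
    noncomm_ring
  rw [hM, mul_add, mul_sub, nonsing_inv_mul_cancel_left _ _ hu,
    nonsing_inv_mul_cancel_left _ _ hu, trace_add, trace_sub, ← mul_assoc, trace_mul_comm,
    ← mul_assoc, mul_nonsing_inv _ hu, one_mul, sub_self, add_zero]

theorem LinearMap.det_id_add_of_isNilpotent {V : Type*} [AddCommGroup V] [Module ℝ V]
    [FiniteDimensional ℝ V] {f : Module.End ℝ V} (hf : IsNilpotent f) :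
    LinearMap.det (LinearMap.id + f) = 1 := by
  have h := LinearMap.eval_charpoly (-f) 1
  rw [(LinearMap.isNilpotent_iff_charpoly _).1 hf.neg] at h
  simpa [Module.End.one_eq_id] using h.symm

theorem stmt5 (A : Type*) [NormedAddCommGroup A] [NormedSpace ℝ A]
    [FiniteDimensional ℝ A]
    (mul : A →ₗ[ℝ] A →ₗ[ℝ] A) (hlsa : IsLSA mul)
    (P : A → ℝ) (hP : ∀ x, P x = LinearMap.det (LinearMap.id + mul.flip x)) :
    List.TFAE [
      -- (i) every R(a) is nilpotent
      (∀ a : A, IsNilpotent (mul.flip a : Module.End ℝ A)),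
      -- (ii) tr R(a) = 0 for all a
      (∀ a : A, LinearMap.trace ℝ A (mul.flip a) = 0),
      -- (iii) the trace form vanishes identically
      (∀ x y : A, LinearMap.trace ℝ A (mul.flip x ∘ₗ mul.flip y) = 0),
      -- (iv) some iterated derivative of log P of order N+1, N ≥ 1, vanishes at 0
      (∃ N : ℕ, 1 ≤ N ∧ iteratedFDeriv ℝ (N + 1) (fun x => Real.log (P x)) 0 = 0),
      -- (v) P ≡ 1
      (∀ x : A, P x = 1),
      -- (vi) P has a critical point at 0
      (fderiv ℝ P 0 = 0),
      -- (vii) P is nowhere vanishing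
      (∀ x : A, P x ≠ 0)] := by
  classical
  let b := Module.finBasis ℝ A
  let Φ := LinearMap.toMatrixAlgEquiv b
  let ρ : A →ₗ[ℝ] Matrix _ _ ℝ := Φ.toLinearMap ∘ₗ mul.flip
  have hPρ : P = fun x => (1 + ρ x).det := by
    ext x
    rw [hP, ← LinearMap.det_toMatrix b, map_add, LinearMap.toMatrix_id]
    rfl
  have htr : ∀ f : Module.End ℝ A, (Φ f).trace = LinearMap.trace ℝ A f := fun f =>
    (LinearMap.trace_eq_matrix_trace ℝ b f).symm
  have hρ : ∀ x v, ρ (mul x v) = ρ v * ρ x + Φ (mul x) * ρ v - ρ v * Φ (mul x) := by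
    intro x v
    simp only [ρ, LinearMap.comp_apply, AlgEquiv.toLinearMap_apply, ← map_mul, ← map_add,
      ← map_sub]
    exact congrArg Φ (hlsa.flip_mul x v)
  have hnil : ∀ k : ℕ, (∀ y z : A, (ρ z ^ k * ρ y).trace = 0) →
      ∀ a : A, IsNilpotent (mul.flip a : Module.End ℝ A) := by
    intro k h
    refine hlsa.isNilpotent_flip k fun y z => ?_
    rw [← htr, map_mul, map_pow]
    exact h y z
  tfae_have 1 → 2 := fun h a => (LinearMap.isNilpotent_trace_of_isNilpotent (h a)).eq_zero
  tfae_have 2 → 3 := by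
    intro h x y
    have := hlsa.trace_flip_pow_mul 0 y x
    rwa [zero_add, pow_one, pow_zero, one_mul, h] at this
  tfae_have 3 → 1 := by
    refine fun h => hnil 1 fun y z => ?_
    rw [pow_one]
    exact (congrArg trace (map_mul Φ _ _)).symm.trans ((htr _).trans (h z y))
  tfae_have 1 → 5 := fun h x => by rw [hP, LinearMap.det_id_add_of_isNilpotent (h x)]
  tfae_have 5 → 4 := by
    refine fun h => ⟨1, le_rfl, ?_⟩
    simp only [h, Real.log_one]
    exact congrFun iteratedFDeriv_fun_zero 0
  tfae_have 4 → 1 := by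
    rintro ⟨N, -, h⟩
    rw [hPρ] at h
    exact hnil N (trace_pow_mul_eq_zero ρ N (trace_pow_eq_zero_of_iteratedFDeriv_log ρ N h))
  tfae_have 5 → 6 := by
    intro h
    rw [show P = fun _ => 1 from funext h]
    exact fderiv_const_apply 1
  tfae_have 6 → 2 := by
    intro h a
    have hd : HasFDerivAt P (0 : A →L[ℝ] ℝ) ((0 : A) + (0 : ℝ) • a) := by
      have hdiff : DifferentiableAt ℝ P 0 := by
        rw [hPρ]
        exact ((contDiff_det.comp (contDiff_const.add
          (LinearMap.toContinuousLinearMap ρ).contDiff)).differentiable (by simp)) 0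
      simpa [h] using hdiff.hasFDerivAt
    have h1 := hd.comp_hasDerivAt (0 : ℝ) (hasDerivAt_const_add_smul (0 : A) a 0)
    have e : (P ∘ fun s : ℝ => (0 : A) + s • a) = fun s : ℝ => (1 + s • ρ a).det := by
      ext s
      simp [hPρ]
    rw [e] at h1
    exact (htr _).symm.trans ((hasDerivAt_det_one_add_smul (ρ a)).unique h1)
  tfae_have 5 → 7 := fun h x => by rw [h]; exact one_ne_zero
  tfae_have 7 → 2 := by
    intro h a
    rw [hPρ] at h
    exact (htr _).symm.trans
      (IsLSA.trace_eq_zero_of_det_ne_zero mul ρ (fun x => Φ (mul x)) hρ h a)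
  tfae_finish
end

section
/- Let (A, ∗) be a finite-dimensional real left-symmetric algebra with characteristic polynomial P(x) = det(id_A + R(x)). Then for every k ≥ 1 and all a₀, a₁, …, a_k ∈ A, the iterated Fréchet derivative of order k+1 of the function x ↦ log P(x) at the point 0, evaluated at the tuple (a₀, a₁, …, a_k), equals (−1)^k · Σ_{σ ∈ S_k} tr( R(a_{σ(1)}) ∘ ⋯ ∘ R(a_{σ(k)}) ∘ R(a₀) ), where the sum is over all permutations σ of {1, …, k}. -/
open Filter Topology

section DetDerivative

variable {A : Type*} [NormedAddCommGroup A] [NormedSpace ℝ A] [FiniteDimensional ℝ A]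

/-- The determinant has derivative the trace at the identity. -/
theorem LinearMap.hasDerivAt_det_one_add_smul (N : Module.End ℝ A) :
    HasDerivAt (fun t : ℝ => LinearMap.det (1 + t • N)) (LinearMap.trace ℝ A N) 0 := by
  classical
  let b := Module.finBasis ℝ A
  set M := LinearMap.toMatrix b b N with hM
  have h (t : ℝ) : LinearMap.det (1 + t • N) = 1 + M.trace * t +
      (Matrix.det (1 + (Polynomial.X : Polynomial ℝ) • M.map Polynomial.C)).divX.divX.eval t
        * t ^ 2 := by
    rw [← Matrix.det_one_add_smul, ← LinearMap.det_toMatrix b, map_add, map_smul,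
      LinearMap.toMatrix_one]
  simp_rw [h, LinearMap.trace_eq_matrix_trace ℝ b N, ← hM]
  have h1 := (((hasDerivAt_id (0 : ℝ)).const_mul M.trace).const_add 1).add
    ((Polynomial.hasDerivAt
      (Matrix.det (1 + (Polynomial.X : Polynomial ℝ) • M.map Polynomial.C)).divX.divX
        (0 : ℝ)).mul ((hasDerivAt_id (0 : ℝ)).pow 2))
  refine h1.congr_deriv ?_
  simp

theorem LinearMap.contDiff_det_one_add (R : A →ₗ[ℝ] Module.End ℝ A) {n : WithTop ℕ∞} :
    ContDiff ℝ n (fun x => LinearMap.det (1 + R x)) := by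
  classical
  let b := Module.finBasis ℝ A
  have h (x : A) : LinearMap.det (1 + R x) = (1 + LinearMap.toMatrix b b (R x)).det := by
    rw [← LinearMap.det_toMatrix b, map_add, LinearMap.toMatrix_one]
  simp_rw [h, Matrix.det_apply]
  refine ContDiff.sum fun σ _ => ContDiff.const_smul _ (contDiff_prod fun i _ => ?_)
  refine contDiff_const.add ?_
  let φ : A →ₗ[ℝ] ℝ := Matrix.entryLinearMap ℝ ℝ (σ i) i ∘ₗ
    (LinearMap.toMatrix b b).toLinearMap ∘ₗ R
  exact φ.toContinuousLinearMap.contDiff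

/-- The logarithmic derivative of `x ↦ det (1 + R x)`, for `R` linear. -/
theorem LinearMap.fderiv_log_det_one_add (R : A →ₗ[ℝ] Module.End ℝ A) {x : A}
    {G : Module.End ℝ A} (hG : (1 + R x) * G = 1) (v : A) :
    fderiv ℝ (fun x => Real.log (LinearMap.det (1 + R x))) x v =
      LinearMap.trace ℝ A (G * R v) := by
  have hdet : LinearMap.det (1 + R x) ≠ 0 := fun h0 => by
    simpa [h0] using congrArg LinearMap.det hG
  have hd : DifferentiableAt ℝ (fun x => Real.log (LinearMap.det (1 + R x))) x :=
    ((R.contDiff_det_one_add (n := 1)).differentiable one_ne_zero x).log hdet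
  rw [← hd.lineDeriv_eq_fderiv]
  refine HasDerivAt.deriv ?_
  have key (t : ℝ) : LinearMap.det (1 + R (x + t • v)) =
      LinearMap.det (1 + R x) * LinearMap.det (1 + t • (G * R v)) := by
    rw [← map_mul, mul_add, mul_one, mul_smul_comm, ← mul_assoc, hG, one_mul, map_add R, map_smul R,
      add_assoc]
  simp_rw [key]
  refine (((LinearMap.hasDerivAt_det_one_add_smul (G * R v)).const_mul _).log
    (by simpa using hdet)).congr_deriv ?_
  simp [hdet]

/-- The iterated derivatives at `0` of `x ↦ log (det (1 + R x))`, for `R` linear. -/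
theorem LinearMap.iteratedFDeriv_log_det_one_add (R : A →ₗ[ℝ] Module.End ℝ A)
    (k : ℕ) (a₀ : A) (a : Fin k → A) :
    iteratedFDeriv ℝ (k + 1) (fun x => Real.log (LinearMap.det (1 + R x))) 0 (Fin.cons a₀ a) =
      (-1 : ℝ) ^ k * ∑ σ : Equiv.Perm (Fin k),
        LinearMap.trace ℝ A ((List.ofFn fun i => R (a (σ i))).prod * R a₀) := by
  have hf : ContDiffAt ℝ ⊤ (fun x => Real.log (LinearMap.det (1 + R x))) 0 :=
    R.contDiff_det_one_add.contDiffAt.log (by simp)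
  rw [← hf.iteratedFDeriv_comp_perm (Fin.cons a₀ a) (finRotate (k + 1)),
    show (Fin.cons a₀ a : Fin (k + 1) → A) ∘ finRotate (k + 1) = Fin.snoc a a₀ from
      (Fin.snoc_eq_cons_rotate a a₀).symm,
    iteratedFDeriv_succ_apply_right, Fin.init_snoc, Fin.snoc_last]
  let u : A →L[ℝ] (A →L[ℝ] A) :=
    LinearMap.toContinuousLinearMap (-(LinearMap.toContinuousLinearMap.toLinearMap ∘ₗ R))
  have hu (x : A) : (u x : Module.End ℝ A) = -R x := by ext; simp [u]
  let L : (A →L[ℝ] A) →L[ℝ] (A →L[ℝ] ℝ) := LinearMap.toContinuousLinearMap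
    (LinearMap.toContinuousLinearMap.toLinearMap ∘ₗ
      (((LinearMap.mul ℝ (Module.End ℝ A)).compr₂ (LinearMap.trace ℝ A)).compl₂ R) ∘ₗ
        ContinuousLinearMap.coeLM ℝ)
  have hL (T : A →L[ℝ] A) (v : A) :
      L T v = LinearMap.trace ℝ A ((T : Module.End ℝ A) * R v) := rfl
  have hev : (fun x => fderiv ℝ (fun x => Real.log (LinearMap.det (1 + R x))) x) =ᶠ[𝓝 0]
      L ∘ ((fun T : A →L[ℝ] A => Ring.inverse (1 - T)) ∘ u) := by
    have hsmall : ∀ᶠ x in 𝓝 (0 : A), ‖u x‖ < 1 :=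
      (u.continuous.norm.tendsto' 0 0 (by simp)).eventually_lt_const one_pos
    filter_upwards [hsmall] with x hx
    ext v
    rw [Function.comp_apply, Function.comp_apply, hL]
    refine R.fderiv_log_det_one_add ?_ v
    have h1 := Ring.mul_inverse_cancel _ (isUnit_one_sub_of_norm_lt_one hx)
    have h2 := congrArg (ContinuousLinearMap.toLinearMapRingHom (R₁ := ℝ) (M₁ := A)) h1
    rw [map_mul, map_sub, map_one] at h2
    simpa [hu] using h2
  rw [(Filter.EventuallyEq.iteratedFDeriv ℝ hev k).eq_of_nhds]
  have hps : HasFPowerSeriesOnBall (fun T : A →L[ℝ] A => Ring.inverse (1 - T))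
      (formalMultilinearSeries_geometric ℝ (A →L[ℝ] A)) (u 0) 1 := by
    rw [map_zero]; exact hasFPowerSeriesOnBall_inverse_one_sub ℝ _
  rw [(L.comp_hasFPowerSeriesOnBall
      hps.compContinuousLinearMap).iteratedFDeriv_eq_sum_of_completeSpace,
    _root_.sum_apply, Finset.mul_sum]
  refine Finset.sum_congr rfl fun σ _ => ?_
  have hprod : ((List.ofFn fun i => u (a (σ i))).prod : Module.End ℝ A) =
      (-1 : ℝ) ^ k • (List.ofFn fun i => R (a (σ i))).prod := by
    change ContinuousLinearMap.toLinearMapRingHom (R₁ := ℝ) (M₁ := A) _ = _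
    rw [map_list_prod, List.map_ofFn]
    have : (⇑(ContinuousLinearMap.toLinearMapRingHom (R₁ := ℝ) (M₁ := A)) ∘
        fun i => u (a (σ i))) = Neg.neg ∘ fun i => R (a (σ i)) := funext fun i => hu _
    rw [this, ← List.map_ofFn, List.prod_map_neg, List.length_ofFn]
    rcases Nat.even_or_odd k with h' | h' <;> simp [h'.neg_one_pow]
  change L (List.ofFn fun i => u (a (σ i))).prod a₀ = _
  rw [hL, hprod, smul_mul_assoc, map_smul, smul_eq_mul]

end DetDerivative

theorem stmt6 (A : Type*) [NormedAddCommGroup A] [NormedSpace ℝ A]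
    [FiniteDimensional ℝ A]
    (mul : A →ₗ[ℝ] A →ₗ[ℝ] A) (hlsa : IsLSA mul)
    (P : A → ℝ) (hP : ∀ x, P x = LinearMap.det (LinearMap.id + mul.flip x))
    (k : ℕ) (hk : 1 ≤ k) (a₀ : A) (a : Fin k → A) :
    iteratedFDeriv ℝ (k + 1) (fun x => Real.log (P x)) 0 (Fin.cons a₀ a) =
      (-1 : ℝ) ^ k * ∑ σ : Equiv.Perm (Fin k),
        LinearMap.trace ℝ A
          (((List.ofFn fun i : Fin k => (mul.flip (a (σ i)) : Module.End ℝ A)).prod)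
            ∘ₗ mul.flip a₀) := by
  obtain rfl : P = fun x => LinearMap.det (LinearMap.id + mul.flip x) := funext hP
  exact LinearMap.iteratedFDeriv_log_det_one_add mul.flip k a₀ a
end

section
/- Let (A, ∗) be a finite-dimensional real left-symmetric algebra that is incomplete (the linear functional x ↦ tr R(x) is not identically zero) and has nondegenerate trace form τ, and let r be the right principal idempotent, i.e. the unique r ∈ A with τ(r,x) = tr R(x) for all x. Then the subspace ker(tr R) is invariant under ad(x) = L(x) − R(x) for every x ∈ A, and the following are equivalent: (i) for every x ∈ ker(tr R), the trace of the restriction of ad(x) to ker(tr R) is zero (i.e. the Lie subalgebra ker(tr R) is unimodular); (ii) (tr R(r))·tr L(x) = (tr L(r))·tr R(x) for all x ∈ A. -/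
/-- The kernel of the linear functional x ↦ tr R(x). -/
noncomputable def kerTrR {A : Type*} [AddCommGroup A] [Module ℝ A]
    [FiniteDimensional ℝ A] (mul : A →ₗ[ℝ] A →ₗ[ℝ] A) : Submodule ℝ A :=
  LinearMap.ker ((LinearMap.trace ℝ A) ∘ₗ mul.flip)

open Polynomial in
/-- If `f - f ^ 2` is a commutator with `f`, all positive powers of `f` have the same trace. -/
lemma trace_mul_aeval_of_commutator {K V : Type*} [Field K] [AddCommGroup V] [Module K V]
    {f g : Module.End K V}
    (h : g * f - f * g = f - f * f) (p : K[X]) :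
    LinearMap.trace K V (f * aeval f p) = p.eval 1 * LinearMap.trace K V f := by
  have hpow (n : ℕ) : LinearMap.trace K V (f ^ (n + 1)) = LinearMap.trace K V f := by
    induction n with
    | zero => simp
    | succ n ih =>
      have h₁ : f ^ n * (g * f - f * g) = f ^ (n + 1) - f ^ (n + 1 + 1) := by
        rw [h, mul_sub, pow_succ, pow_succ, pow_succ, mul_assoc]
      have h₂ : LinearMap.trace K V (f ^ n * (g * f - f * g)) = 0 := by
        rw [mul_sub, map_sub, ← mul_assoc, LinearMap.trace_mul_comm, ← mul_assoc, ← mul_assoc,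
          ← pow_succ, ← pow_succ', sub_self]
      rw [h₁, map_sub, sub_eq_zero] at h₂
      rw [← h₂, ih]
  induction p using Polynomial.induction_on' with
  | add p q hp hq => simp only [map_add, mul_add, hp, hq, eval_add, add_mul]
  | monomial n a =>
    rw [aeval_monomial, ← Algebra.smul_def, mul_smul_comm, ← pow_succ', map_smul, hpow]
    simp

open Polynomial in
/-- If `f - f ^ 2` is a commutator with `f` and `f` has a nonzero fixed vector, then `f` has
nonzero trace. -/
lemma trace_ne_zero_of_commutator {K V : Type*} [Field K] [CharZero K] [AddCommGroup V]
    [Module K V] [FiniteDimensional K V] {f g : Module.End K V}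
    (h : g * f - f * g = f - f * f) {v : V} (hv : f v = v) (hv0 : v ≠ 0) :
    LinearMap.trace K V f ≠ 0 := by
  intro htr
  obtain ⟨q, hq, hndvd⟩ := exists_eq_pow_rootMultiplicity_mul_and_not_dvd (minpoly K f)
    (minpoly.ne_zero (Algebra.IsIntegral.isIntegral f)) 1
  set k := (minpoly K f).rootMultiplicity 1
  have hirr := irreducible_X_sub_C (1 : K)
  have hX : ¬ (X - C (1 : K)) ∣ X := by rw [dvd_iff_isRoot]; simp
  have hcop : IsCoprime ((X - C (1 : K)) ^ k) (X * q) :=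
    (hirr.coprime_iff_not_dvd.2 fun hd => (hirr.prime.dvd_or_dvd hd).elim hX hndvd).pow_left
  obtain ⟨a, b, hab⟩ := hcop
  -- `aeval f (b * (X * q))` is the projection onto the generalized `1`-eigenspace of `f`.
  have hidem : IsIdempotentElem (aeval f (b * (X * q))) := by
    have hs : b * (X * q) * (b * (X * q)) = b * (X * q) - a * b * X * minpoly K f := by
      rw [hq]
      linear_combination (b * (X * q)) * hab
    rw [IsIdempotentElem, ← map_mul, hs, map_sub, map_mul _ _ (minpoly K f), minpoly.aeval,
      mul_zero, sub_zero]
  have htrace : LinearMap.trace K V (aeval f (b * (X * q))) = 0 := by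
    rw [show b * (X * q) = X * (b * q) by ring, map_mul, aeval_X,
      trace_mul_aeval_of_commutator h, htr, mul_zero]
  have hzero := LinearMap.IsIdempotentElem.eq_zero_of_trace_eq_zero hidem htrace
  have heig : ∀ p : K[X], aeval f p v = p.eval 1 • v := fun p =>
    Module.End.aeval_apply_of_hasEigenvector
      ⟨Module.End.mem_eigenspace_iff.2 (by rw [hv, one_smul]), hv0⟩
  have hmin : (minpoly K f).eval 1 = 0 := by
    have := heig (minpoly K f)
    rw [minpoly.aeval, LinearMap.zero_apply] at this
    exact (smul_eq_zero.1 this.symm).resolve_right hv0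
  have hb : (b * (X * q)).eval 1 = 0 := by
    have := heig (b * (X * q))
    rw [hzero, LinearMap.zero_apply] at this
    exact (smul_eq_zero.1 this.symm).resolve_right hv0
  have hk : ((X - C (1 : K)) ^ k).eval 1 = 0 := by
    have hq1 : q.eval 1 ≠ 0 := fun h0 => hndvd (dvd_iff_isRoot.2 h0)
    rw [hq, eval_mul] at hmin
    exact (mul_eq_zero.1 hmin).resolve_right hq1
  have := congrArg (eval 1) hab
  rw [eval_add, hb, eval_mul, hk] at this
  simp at this

namespace IsLSA

variable {A : Type*} [AddCommGroup A] [Module ℝ A] {mul : A →ₗ[ℝ] A →ₗ[ℝ] A}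

lemma commutator_left_right (h : IsLSA mul) (y z : A) :
    mul y * mul.flip z - mul.flip z * mul y
      = mul.flip (mul y z) - mul.flip z * mul.flip y := by
  ext x
  have := h x y z
  simp only [LinearMap.sub_apply, Module.End.mul_apply, LinearMap.flip_apply]
  rw [sub_eq_sub_iff_add_eq_add] at this ⊢
  rw [← sub_eq_zero] at this ⊢
  rw [← this]
  abel

lemma trace_right_mul (h : IsLSA mul) (x y : A) :
    LinearMap.trace ℝ A (mul.flip (mul x y))
      = LinearMap.trace ℝ A (mul.flip x ∘ₗ mul.flip y) := by
  have := congrArg (LinearMap.trace ℝ A) (h.commutator_left_right x y)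
  rw [map_sub, map_sub, LinearMap.trace_mul_comm, sub_self, eq_comm, sub_eq_zero,
    LinearMap.trace_mul_comm] at this
  exact this

lemma trace_right_mul_comm (h : IsLSA mul) (x y : A) :
    LinearMap.trace ℝ A (mul.flip (mul x y)) = LinearMap.trace ℝ A (mul.flip (mul y x)) := by
  rw [h.trace_right_mul, h.trace_right_mul]
  exact LinearMap.trace_mul_comm ℝ _ _

/-- The element representing `tr R` under a nondegenerate trace form is idempotent. -/
lemma mul_self_of_trace_right (h : IsLSA mul)
    (hnd : ∀ x, (∀ y, LinearMap.trace ℝ A (mul.flip (mul x y)) = 0) → x = 0) {r : A}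
    (hr : ∀ x, LinearMap.trace ℝ A (mul.flip (mul r x)) = LinearMap.trace ℝ A (mul.flip x)) :
    mul r r = r := by
  rw [← sub_eq_zero]
  refine hnd _ fun y => ?_
  have h₁ := congrArg (fun x => LinearMap.trace ℝ A (mul.flip x)) (h r y r)
  simp only [map_sub] at h₁
  rw [h.trace_right_mul_comm (mul r y) r, h.trace_right_mul_comm (mul y r) r, hr, hr, hr,
    h.trace_right_mul_comm y r, hr, h.trace_right_mul_comm y (mul r r)] at h₁
  rw [map_sub, LinearMap.sub_apply, map_sub, map_sub, hr]
  linarith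

end IsLSA

theorem stmt14 (A : Type*) [AddCommGroup A] [Module ℝ A] [FiniteDimensional ℝ A]
    (mul : A →ₗ[ℝ] A →ₗ[ℝ] A) (hlsa : IsLSA mul)
    (hincomplete : ∃ x : A, LinearMap.trace ℝ A (mul.flip x) ≠ 0)
    (τ : A → A → ℝ)
    (hτ : ∀ x y, τ x y = LinearMap.trace ℝ A (mul.flip x ∘ₗ mul.flip y))
    (hnd : ∀ x, (∀ y, τ x y = 0) → x = 0)
    (r : A) (hr : ∀ x, τ r x = LinearMap.trace ℝ A (mul.flip x)) :
    ∃ hK : ∀ x : A, ∀ y ∈ kerTrR mul, (mul x - mul.flip x) y ∈ kerTrR mul,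
      ((∀ x ∈ kerTrR mul,
          LinearMap.trace ℝ ↥(kerTrR mul) ((mul x - mul.flip x).restrict (hK x)) = 0) ↔
        (∀ x : A,
          LinearMap.trace ℝ A (mul.flip r) * LinearMap.trace ℝ A (mul x) =
            LinearMap.trace ℝ A (mul r) * LinearMap.trace ℝ A (mul.flip x))) := by
  have hτ' : ∀ x y, τ x y = LinearMap.trace ℝ A (mul.flip (mul x y)) := fun x y => by
    rw [hτ, hlsa.trace_right_mul]
  simp only [hτ'] at hnd hr
  have mem (x : A) : x ∈ kerTrR mul ↔ LinearMap.trace ℝ A (mul.flip x) = 0 := LinearMap.mem_ker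
  have had : ∀ x y : A, (mul x - mul.flip x) y ∈ kerTrR mul := fun x y => by
    rw [mem, LinearMap.sub_apply, LinearMap.flip_apply, map_sub, map_sub,
      hlsa.trace_right_mul_comm, sub_self]
  have hrr := hlsa.mul_self_of_trace_right hnd hr
  have hr0 : r ≠ 0 := by
    rintro rfl
    obtain ⟨x, hx⟩ := hincomplete
    exact hx (by rw [← hr]; simp)
  have hfr : LinearMap.trace ℝ A (mul.flip r) ≠ 0 := by
    have hc := hlsa.commutator_left_right r r
    rw [hrr] at hc
    exact trace_ne_zero_of_commutator hc hrr hr0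
  refine ⟨fun x y _ => had x y, ?_⟩
  have htr (x : A) (hx : x ∈ kerTrR mul) :
      LinearMap.trace ℝ ↥(kerTrR mul) ((mul x - mul.flip x).restrict fun y _ => had x y)
        = LinearMap.trace ℝ A (mul x) := by
    rw [LinearMap.trace_restrict_eq_of_forall_mem _ _ (had x), map_sub, (mem x).1 hx, sub_zero]
  constructor
  · intro h x
    have hx : LinearMap.trace ℝ A (mul.flip r) • x - LinearMap.trace ℝ A (mul.flip x) • r
        ∈ kerTrR mul := by
      rw [mem]
      simp only [map_sub, map_smul, smul_eq_mul]
      ring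
    have h₁ := h _ hx
    rw [htr _ hx] at h₁
    simp only [map_sub, map_smul, smul_eq_mul] at h₁
    linarith
  · intro h x hx
    have h₁ := h x
    rw [(mem x).1 hx, mul_zero] at h₁
    rw [htr x hx]
    exact (mul_eq_zero.1 h₁).resolve_left hfr
end

section
/- Let (A, ∗) be an incomplete finite-dimensional real left-symmetric algebra with nondegenerate trace form τ and right principal idempotent r, and suppose ker(tr R) = ker R(r). Let B = ker(tr R). Then: (i) for all x, y ∈ B the element x∘y := x∗y − τ(x,y)·r lies in B, the multiplication ∘ makes B a left-symmetric algebra, and (B, ∘) is complete (id_B + R_∘(x) is invertible for every x ∈ B, where R_∘(x)y = y∘x); (ii) the underlying Lie algebra of (A, ∗) is solvable; (iii) the characteristic polynomial satisfies P(x + t·r) = P(x) + t for all x ∈ A and t ∈ ℝ. -/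
/-- The multiplication x∘y = x∗y − τ(x,y)·r. -/
def cmul {A : Type*} [AddCommGroup A] [Module ℝ A]
    (mul : A →ₗ[ℝ] A →ₗ[ℝ] A) (τ : A → A → ℝ) (r : A) (x y : A) : A :=
  mul x y - τ x y • r

/-- Derived series of the underlying Lie algebra. -/
def derSeriesLSA {A : Type*} [AddCommGroup A] [Module ℝ A]
    (mul : A →ₗ[ℝ] A →ₗ[ℝ] A) : ℕ → Submodule ℝ A
  | 0 => ⊤
  | (i + 1) => Submodule.span ℝ
      {z : A | ∃ x ∈ derSeriesLSA mul i, ∃ y ∈ derSeriesLSA mul i,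
        z = mul x y - mul y x}

open Polynomial in
/-- In characteristic zero an endomorphism all of whose positive powers are traceless is
nilpotent. -/
theorem isNilpotent_of_forall_trace_pow_eq_zero {K V : Type*} [Field K] [CharZero K]
    [AddCommGroup V] [Module K V] [FiniteDimensional K V] (T : Module.End K V)
    (hT : ∀ k : ℕ, LinearMap.trace K V (T ^ (k + 1)) = 0) : IsNilpotent T := by
  obtain ⟨g, hg, hXg⟩ := exists_eq_pow_rootMultiplicity_mul_and_not_dvd (minpoly K T)
    (minpoly.ne_zero (Algebra.IsIntegral.isIntegral T)) 0
  set a := (minpoly K T).rootMultiplicity 0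
  rw [C_0, sub_zero] at hg hXg
  have hcop : IsCoprime ((X : K[X]) ^ (a + 1)) g :=
    ((prime_X.irreducible.coprime_iff_not_dvd).2 hXg).pow_left
  obtain ⟨c, d, hcd⟩ := hcop
  have hzero : T ^ a * aeval T g = 0 := by
    have := minpoly.aeval K T
    rw [hg] at this
    simpa using this
  set p := c * X ^ (a + 1) with hp
  have hidem : IsIdempotentElem (aeval T p) := by
    have h1 : p * p - p = X ^ a * g * (- d * c * X) := by
      have : p - 1 = - (d * g) := by rw [← hcd]; ring
      calc p * p - p = p * (p - 1) := by ring
        _ = _ := by rw [this, hp]; ring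
    have h2 : aeval T (p * p - p) = 0 := by
      rw [h1, map_mul, map_mul, map_pow, aeval_X, hzero, zero_mul]
    rw [map_sub, map_mul, sub_eq_zero] at h2
    exact h2
  have htr : LinearMap.trace K V (aeval T p) = 0 := by
    rw [hp, map_mul, map_pow, aeval_X, aeval_eq_sum_range, Finset.sum_mul, map_sum]
    refine Finset.sum_eq_zero fun i _ ↦ ?_
    rw [smul_mul_assoc, ← pow_add, ← add_assoc, map_smul, hT, smul_zero]
  have hz : aeval T p = 0 := LinearMap.IsIdempotentElem.eq_zero_of_trace_eq_zero hidem htr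
  refine ⟨a, ?_⟩
  have h1 := congrArg (aeval T) hcd
  rw [map_add, hz, zero_add, map_mul, map_one] at h1
  calc T ^ a = T ^ a * (aeval T d * aeval T g) := by rw [h1, mul_one]
    _ = T ^ a * aeval T g * aeval T d := by
      rw [← map_mul, mul_comm d g, map_mul, mul_assoc]
    _ = 0 := by rw [hzero, zero_mul]

section Sl2
variable {K V : Type*} [Field K] [AddCommGroup V] [Module K V]

/-- Three endomorphisms satisfying the commutation relations of `sl₂` (and possibly zero). -/
structure Sl2Rel (H E F : Module.End K V) : Prop where
  lie_h_e : H * E - E * H = (2 : K) • E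
  lie_h_f : H * F - F * H = -((2 : K) • F)
  lie_e_f : E * F - F * E = H

namespace Sl2Rel
variable {H E F : Module.End K V}

theorem symm (t : Sl2Rel H E F) : Sl2Rel (-H) F E where
  lie_h_e := by rw [← neg_inj, ← t.lie_h_f, neg_mul, mul_neg]; abel
  lie_h_f := by rw [← t.lie_h_e, neg_mul, mul_neg]; abel
  lie_e_f := by rw [← t.lie_e_f, neg_sub]

theorem h_e_apply (t : Sl2Rel H E F) (w : V) : H (E w) = E (H w) + (2 : K) • E w := by
  have := LinearMap.congr_fun t.lie_h_e w
  simp only [LinearMap.sub_apply, Module.End.mul_apply, LinearMap.smul_apply] at this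
  rw [← this]; abel

theorem h_f_apply (t : Sl2Rel H E F) (w : V) : H (F w) = F (H w) - (2 : K) • F w := by
  have := LinearMap.congr_fun t.lie_h_f w
  simp only [LinearMap.sub_apply, Module.End.mul_apply, LinearMap.neg_apply,
    LinearMap.smul_apply] at this
  rw [sub_eq_add_neg, ← this]; abel

theorem e_f_apply (t : Sl2Rel H E F) (w : V) : E (F w) = F (E w) + H w := by
  have := LinearMap.congr_fun t.lie_e_f w
  simp only [LinearMap.sub_apply, Module.End.mul_apply] at this
  rw [← this]; abel

theorem h_e_pow_apply (t : Sl2Rel H E F) (k : ℕ) (w : V) :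
    H ((E ^ k) w) = (E ^ k) (H w) + (2 * k : K) • (E ^ k) w := by
  induction k generalizing w with
  | zero => simp
  | succ k ih =>
    rw [pow_succ, Module.End.mul_apply, ih, t.h_e_apply, map_add, map_smul]
    simp only [Module.End.mul_apply, Nat.cast_succ]
    module

theorem e_f_pow_succ_apply (t : Sl2Rel H E F) (k : ℕ) (w : V) :
    E ((F ^ (k + 1)) w) = (F ^ (k + 1)) (E w) + (k + 1 : K) • (F ^ k) (H w - (k : K) • w) := by
  induction k generalizing w with
  | zero => simp [t.e_f_apply]
  | succ k ih =>
    rw [pow_succ, Module.End.mul_apply, ih, t.e_f_apply, t.h_f_apply]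
    simp only [Module.End.mul_apply, Nat.cast_succ, pow_succ, map_add, map_sub, map_smul]
    module

theorem f_e_pow_succ_apply (t : Sl2Rel H E F) (k : ℕ) (w : V) :
    F ((E ^ (k + 1)) w) = (E ^ (k + 1)) (F w) - (k + 1 : K) • (E ^ k) (H w + (k : K) • w) := by
  rw [t.symm.e_f_pow_succ_apply]
  simp only [LinearMap.neg_apply, map_sub, map_neg, map_add]
  module

variable [CharZero K] [FiniteDimensional K V]

theorem isNilpotent_e (t : Sl2Rel H E F) : IsNilpotent E := by
  refine isNilpotent_of_forall_trace_pow_eq_zero E fun k ↦ ?_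
  have h : H * E ^ (k + 1) - E ^ (k + 1) * H = (2 * (k + 1 : ℕ) : K) • E ^ (k + 1) := by
    ext w
    simp [t.h_e_pow_apply]
  have h2 := congrArg (LinearMap.trace K V) h
  rw [map_sub, LinearMap.trace_mul_comm, sub_self, map_smul, smul_eq_mul] at h2
  exact (mul_eq_zero.1 h2.symm).resolve_left
    (mul_ne_zero two_ne_zero (Nat.cast_ne_zero.2 k.succ_ne_zero))

theorem isNilpotent_f (t : Sl2Rel H E F) : IsNilpotent F := t.symm.isNilpotent_e

theorem eq_zero_of_e_f_eq_zero (t : Sl2Rel H E F) {n : ℕ} {w : V}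
    (hw : H w = (n + 1 : K) • w) (hEF : E (F w) = 0) : w = 0 := by
  obtain ⟨N, hN⟩ := t.isNilpotent_e
  suffices h : ∀ k : ℕ, (E ^ k) w = 0 → w = 0 from h N (by simp [hN])
  intro k
  induction k with
  | zero => simp
  | succ k ih =>
    intro hk
    have := t.f_e_pow_succ_apply k w
    rw [hk, map_zero, pow_succ, Module.End.mul_apply, hEF, map_zero, zero_sub, hw, ← add_smul,
      map_smul, smul_smul, eq_comm, neg_eq_zero, smul_eq_zero] at this
    refine ih (this.resolve_left (mul_ne_zero ?_ ?_))
    · exact_mod_cast k.succ_ne_zero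
    · norm_cast; omega

theorem exists_e_f_eq (t : Sl2Rel H E F) {n : ℕ} {u : V} (hu : H u = (n + 1 : K) • u) :
    ∃ z, H z = (n + 1 : K) • z ∧ E (F z) = u := by
  let W := Module.End.eigenspace H (n + 1 : K)
  have hmaps : ∀ z ∈ W, (E * F) z ∈ W := by
    intro z hz
    rw [Module.End.mem_eigenspace_iff] at hz ⊢
    rw [Module.End.mul_apply, t.h_e_apply, t.h_f_apply, hz]
    simp only [map_sub, map_smul]
    module
  have hinj : Function.Injective ((E * F).restrict hmaps) := by
    rw [injective_iff_map_eq_zero]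
    rintro ⟨z, hz⟩ h
    have h' : E (F z) = 0 := congrArg Subtype.val h
    exact Subtype.ext (t.eq_zero_of_e_f_eq_zero (Module.End.mem_eigenspace_iff.1 hz) h')
  obtain ⟨z, hz⟩ := LinearMap.surjective_of_injective hinj ⟨u, Module.End.mem_eigenspace_iff.2 hu⟩
  exact ⟨z, Module.End.mem_eigenspace_iff.1 z.2, congrArg Subtype.val hz⟩

open Polynomial in
omit [CharZero K] [FiniteDimensional K V] in
theorem e_pow_f_pow_apply (t : Sl2Rel H E F) (k : ℕ) (w : V) (hw : E w = 0) :
    (E ^ k) ((F ^ k) w) = (k.factorial : K) • aeval H (∏ i ∈ Finset.range k, (X - C (i : K))) w := by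
  induction k generalizing w with
  | zero => simp
  | succ k ih =>
    have hw' : E (H w - (k : K) • w) = 0 := by
      have := t.h_e_apply w
      rw [hw, map_zero, smul_zero, add_zero] at this
      simp [← this, hw]
    rw [pow_succ E, Module.End.mul_apply, t.e_f_pow_succ_apply, hw, map_zero, zero_add, map_smul,
      ih _ hw', Finset.prod_range_succ, map_mul, Module.End.mul_apply, smul_smul,
      Nat.factorial_succ]
    simp [← Nat.cast_smul_eq_nsmul K]

open Polynomial in
theorem aeval_prod_apply_eq_zero (t : Sl2Rel H E F) {w : V} (hw : E w = 0) :
    ∃ N : ℕ, ∀ k ≥ N, aeval H (∏ i ∈ Finset.range k, (X - C (i : K))) w = 0 := by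
  obtain ⟨N, hN⟩ := t.isNilpotent_f
  refine ⟨N, fun k hk ↦ ?_⟩
  have := t.e_pow_f_pow_apply k w hw
  rw [pow_eq_zero_of_le hk hN, LinearMap.zero_apply, map_zero, eq_comm, smul_eq_zero] at this
  exact this.resolve_left (by exact_mod_cast k.factorial_ne_zero)

open Polynomial in
omit [CharZero K] [FiniteDimensional K V] in
theorem aeval_apply_of_h_eq (p : K[X]) {μ : K} {w : V} (hw : H w = μ • w) :
    aeval H p w = p.eval μ • w := by
  by_cases h0 : w = 0
  · simp [h0]
  · exact Module.End.aeval_apply_of_hasEigenvector ⟨Module.End.mem_eigenspace_iff.2 hw, h0⟩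

open Polynomial in
theorem exists_nat_of_e_eq_zero (t : Sl2Rel H E F) {μ : K} {w : V} (hw : H w = μ • w)
    (hE : E w = 0) (h0 : w ≠ 0) : ∃ n : ℕ, μ = n := by
  obtain ⟨N, hN⟩ := t.aeval_prod_apply_eq_zero hE
  have h := hN N le_rfl
  rw [aeval_apply_of_h_eq _ hw, smul_eq_zero, or_iff_left h0, eval_prod,
    Finset.prod_eq_zero_iff] at h
  obtain ⟨i, -, hi⟩ := h
  exact ⟨i, by simpa [sub_eq_zero] using hi⟩

open Polynomial in
/-- `H` acts semisimply on the primitive vectors. -/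
theorem h_apply_eq_of_e_eq_zero (t : Sl2Rel H E F) {n : ℕ} {w c : V}
    (hw : H w = (n : K) • w + c) (hc : H c = (n : K) • c) (hE : E w = 0) : c = 0 := by
  obtain ⟨N, hN⟩ := t.aeval_prod_apply_eq_zero hE
  have h := hN (max N (n + 1)) (le_max_left _ _)
  have hn : n ∈ Finset.range (max N (n + 1)) := by simp
  rw [← Finset.prod_erase_mul _ _ hn, map_mul, Module.End.mul_apply] at h
  have h1 : aeval H (X - C (n : K)) w = c := by simp [hw, ← Nat.cast_smul_eq_nsmul K]
  rw [h1, aeval_apply_of_h_eq _ hc, smul_eq_zero] at h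
  refine h.resolve_left ?_
  rw [← ne_eq, eval_prod, Finset.prod_ne_zero_iff]
  intro i hi
  simp only [eval_sub, eval_X, eval_C, sub_ne_zero, ne_eq, Nat.cast_inj]
  exact (Finset.ne_of_mem_erase hi).symm

/-- In a finite-dimensional representation of `sl₂` the element `h` acts semisimply. -/
theorem eq_zero_of_h_apply_eq (t : Sl2Rel H E F) {μ : K} {w c : V}
    (hw : H w = μ • w + c) (hc : H c = μ • c) : c = 0 := by
  by_contra hc0
  have hex : ∃ k : ℕ, (E ^ k) c = 0 := by
    obtain ⟨N, hN⟩ := t.isNilpotent_e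
    exact ⟨N, by simp [hN]⟩
  classical
  obtain ⟨j, hj⟩ : ∃ j, Nat.find hex = j + 1 := by
    refine Nat.exists_eq_succ_of_ne_zero fun h ↦ hc0 ?_
    simpa using (Nat.find_eq_zero hex).1 h
  have hjs : E ((E ^ j) c) = 0 := by
    rw [← Module.End.mul_apply, ← pow_succ', ← hj]
    exact Nat.find_spec hex
  have hj0 : (E ^ j) c ≠ 0 := Nat.find_min hex (by omega)
  have hHc : H ((E ^ j) c) = (μ + 2 * j) • (E ^ j) c := by
    rw [t.h_e_pow_apply, hc, map_smul, add_smul]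
  have hHw : H ((E ^ j) w) = (μ + 2 * j) • (E ^ j) w + (E ^ j) c := by
    rw [t.h_e_pow_apply, hw, map_add, map_smul]; module
  obtain ⟨n, hn⟩ := t.exists_nat_of_e_eq_zero hHc hjs hj0
  rw [hn] at hHc hHw
  have hu : H (E ((E ^ j) w)) = ((n + 1 : ℕ) + 1 : K) • E ((E ^ j) w) := by
    rw [t.h_e_apply, hHw, map_add, hjs, map_smul]
    push_cast; module
  obtain ⟨z, hz, hzu⟩ := t.exists_e_f_eq hu
  refine hj0 (t.h_apply_eq_of_e_eq_zero (n := n) (w := (E ^ j) w - F z) ?_ hHc ?_)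
  · rw [map_sub, hHw, t.h_f_apply, hz, map_smul]
    push_cast; module
  · rw [map_sub, hzu, sub_self]

theorem exists_eq_add (t : Sl2Rel H E F) (μ : K) (u : V) :
    ∃ v p : V, H v = μ • v ∧ u = v + (H p - μ • p) := by
  set T : Module.End K V := H - μ • 1 with hT
  have hdisj : Disjoint (LinearMap.ker T) (LinearMap.range T) := by
    rw [Submodule.disjoint_def]
    rintro c hc ⟨w, rfl⟩
    refine t.eq_zero_of_h_apply_eq (w := w) ?_ (sub_eq_zero.1 hc)
    simp [hT]
  have htop := Submodule.eq_top_of_disjoint _ _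
    (by rw [add_comm, LinearMap.finrank_range_add_finrank_ker]) hdisj
  obtain ⟨v, hv, _, ⟨p, rfl⟩, rfl⟩ := Submodule.mem_sup.1 (htop ▸ Submodule.mem_top : u ∈ _)
  exact ⟨v, p, sub_eq_zero.1 hv, by simp [hT]⟩

end Sl2Rel
end Sl2

section Lift
variable {K L : Type*} [Field K] [LieRing L] [LieAlgebra K L] {I : LieIdeal K L}

theorem sl2Rel_toEnd_of_mem (hI : ∀ x ∈ I, ∀ y ∈ I, ⁅x, y⁆ = 0) {h e f : L}
    (he : ⁅h, e⁆ - (2 : K) • e ∈ I) (hf : ⁅h, f⁆ + (2 : K) • f ∈ I) (hef : ⁅e, f⁆ - h ∈ I) :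
    Sl2Rel (LieModule.toEnd K L I h) (LieModule.toEnd K L I e) (LieModule.toEnd K L I f) where
  lie_h_e := by
    ext x
    have := hI _ he x x.2
    rw [sub_lie, lie_lie, smul_lie, sub_eq_zero] at this
    simpa using this
  lie_h_f := by
    ext x
    have := hI _ hf x x.2
    rw [add_lie, lie_lie, smul_lie, add_eq_zero_iff_eq_neg] at this
    simpa using this
  lie_e_f := by
    ext x
    have := hI _ hef x x.2
    rw [sub_lie, lie_lie, sub_eq_zero] at this
    simpa using this

variable [CharZero K] [FiniteDimensional K L]

theorem exists_lie_eq_smul_add {h e f x : L} (μ : K)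
    (t : Sl2Rel (LieModule.toEnd K L I h) (LieModule.toEnd K L I e) (LieModule.toEnd K L I f))
    (hx : ⁅h, x⁆ - μ • x ∈ I) :
    ∃ p ∈ I, ∃ u ∈ I, ⁅h, x + p⁆ = μ • (x + p) + u ∧ ⁅h, u⁆ = μ • u := by
  obtain ⟨v, p, hv, hp⟩ := t.exists_eq_add μ ⟨_, hx⟩
  have hv' := congrArg Subtype.val hv
  have hp' := congrArg Subtype.val hp
  simp only [LieModule.toEnd_apply_apply, LieSubmodule.coe_bracket, LieSubmodule.coe_smul,
    LieSubmodule.coe_add, LieSubmodule.coe_sub] at hv' hp'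
  refine ⟨-p, neg_mem p.2, v, v.2, ?_, hv'⟩
  rw [lie_add, lie_neg]
  rw [sub_eq_iff_eq_add] at hp'
  rw [hp']
  module

theorem exists_lie_eq_of_sl2_modulo (hI : ∀ x ∈ I, ∀ y ∈ I, ⁅x, y⁆ = 0) {h₀ e₀ f₀ : L}
    (he : ⁅h₀, e₀⁆ - (2 : K) • e₀ ∈ I) (hf : ⁅h₀, f₀⁆ + (2 : K) • f₀ ∈ I)
    (hef : ⁅e₀, f₀⁆ - h₀ ∈ I) :
    ∃ h e f u v : L, h - h₀ ∈ I ∧ u ∈ I ∧ v ∈ I ∧ ⁅e, f⁆ = h ∧ ⁅h, e⁆ = (2 : K) • e + u ∧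
      ⁅h, f⁆ = -((2 : K) • f) + v ∧ ⁅h, u⁆ = (2 : K) • u ∧ ⁅h, v⁆ = -((2 : K) • v) := by
  have t := sl2Rel_toEnd_of_mem hI he hf hef
  obtain ⟨p, hp, u, hu, hhe, hhu⟩ := exists_lie_eq_smul_add 2 t he
  obtain ⟨q, hq, v, hv, hhf, hhv⟩ := exists_lie_eq_smul_add (x := f₀) (-2) t
    (by rwa [neg_smul, sub_neg_eq_add])
  set e := e₀ + p
  set f := f₀ + q
  rw [neg_smul] at hhf hhv
  have hi : ⁅e, f⁆ - h₀ ∈ I := by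
    have : ⁅e, f⁆ - h₀ = ⁅e₀, f₀⁆ - h₀ + ⁅e₀, q⁆ + ⁅p, f⁆ := by
      simp only [e, f, lie_add, add_lie]; abel
    rw [this]
    exact add_mem (add_mem hef (lie_mem_right K L I _ _ hq)) (lie_mem_left K L I _ _ hp)
  set i := ⁅e, f⁆ - h₀ with hi_def
  have hh0i : ⁅h₀, i⁆ = ⁅u, f⁆ + ⁅e, v⁆ := by
    rw [hi_def, lie_sub, lie_self, leibniz_lie, hhe, hhf]
    simp only [add_lie, lie_add, smul_lie, lie_neg, lie_smul]; module
  have hh0h0i : ⁅h₀, ⁅h₀, i⁆⁆ = 0 := by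
    rw [hh0i, lie_add, leibniz_lie, leibniz_lie h₀ e, hhe, hhf, hhu, hhv]
    simp only [add_lie, lie_add, smul_lie, lie_neg, lie_smul, hI u hu v hv]; module
  have hh0i0 : ⁅h₀, i⁆ = 0 := by
    have := t.eq_zero_of_h_apply_eq (μ := 0) (w := ⟨i, hi⟩) (c := ⁅h₀, ⟨i, hi⟩⁆) (by simp)
      (by rw [zero_smul]; exact Subtype.ext hh0h0i)
    exact congrArg Subtype.val this
  have hh : ⁅e, f⁆ = h₀ + i := by rw [hi_def]; abel
  have hmem : ∀ w ∈ I, ⁅⁅e, f⁆, w⁆ = ⁅h₀, w⁆ := fun w hw ↦ by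
    rw [hh, add_lie, hI i hi w hw, add_zero]
  have hie : ⁅i, e⁆ ∈ I := lie_mem_left K L I _ _ hi
  have hif : ⁅i, f⁆ ∈ I := lie_mem_left K L I _ _ hi
  refine ⟨⁅e, f⁆, e, f, u + ⁅i, e⁆, v + ⁅i, f⁆, hi, add_mem hu hie, add_mem hv hif, rfl,
    ?_, ?_, ?_, ?_⟩
  · rw [hh, add_lie, hhe, add_assoc]
  · rw [hh, add_lie, hhf, add_assoc]
  · rw [hmem _ (add_mem hu hie), lie_add, leibniz_lie, hh0i0, hhe, hhu, zero_lie, lie_add,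
      lie_smul, hI i hi u hu]
    module
  · rw [hmem _ (add_mem hv hif), lie_add, leibniz_lie, hh0i0, hhf, hhv, zero_lie, lie_add,
      lie_neg, lie_smul, hI i hi v hv]
    module

/-- An `sl₂`-triple modulo an abelian ideal lifts to an `sl₂`-triple. -/
theorem exists_isSl2Triple_of_sl2_modulo (hI : ∀ x ∈ I, ∀ y ∈ I, ⁅x, y⁆ = 0) {h₀ e₀ f₀ : L}
    (h0 : h₀ ∉ I)
    (he : ⁅h₀, e₀⁆ - (2 : K) • e₀ ∈ I) (hf : ⁅h₀, f₀⁆ + (2 : K) • f₀ ∈ I)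
    (hef : ⁅e₀, f₀⁆ - h₀ ∈ I) : ∃ h e f : L, IsSl2Triple h e f := by
  obtain ⟨h, e, f, u, v, hh, hu, hv, hef, hhe, hhf, hhu, hhv⟩ :=
    exists_lie_eq_of_sl2_modulo hI he hf hef
  have t := sl2Rel_toEnd_of_mem (K := K) hI (h := h) (e := e) (f := f) (by simpa [hhe])
    (by simpa [hhf]) (by simp [hef])
  obtain ⟨⟨p, hp⟩, hp2, hpu⟩ := t.exists_e_f_eq (n := 1) (u := ⟨-u, neg_mem hu⟩)
    (Subtype.ext (by simp [hhu]; norm_num))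
  have hhp : ⁅h, p⁆ = (2 : K) • p := by
    have := congrArg Subtype.val hp2
    norm_num at this; exact this
  have hefp : ⁅e, ⁅f, p⁆⁆ = -u := congrArg Subtype.val hpu
  have hpf : ⁅p, f⁆ ∈ I := lie_mem_left K L I _ _ hp
  have hpff : ⁅⁅p, f⁆, f⁆ ∈ I := lie_mem_left K L I _ _ hpf
  have hhpf : ⁅h, ⁅p, f⁆⁆ = 0 := by
    rw [leibniz_lie, hhp, hhf, smul_lie, lie_add, lie_neg, lie_smul, hI p hp v hv]; module
  have hhe' : ⁅h + ⁅p, f⁆, e + p⁆ = (2 : K) • (e + p) := by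
    rw [lie_add, add_lie, add_lie, hI _ hpf p hp, hhe, hhp, ← lie_skew _ e, ← lie_skew p f,
      lie_neg, neg_neg, hefp]
    module
  set v' := v + ⁅⁅p, f⁆, f⁆ with hv'_def
  have hv' : v' ∈ I := add_mem hv hpff
  have hhf' : ⁅h + ⁅p, f⁆, f⁆ = -((2 : K) • f) + v' := by
    rw [add_lie, hhf, add_assoc]
  have hhv' : ⁅h, v'⁆ = -((2 : K) • v') := by
    rw [hv'_def, lie_add, leibniz_lie, hhpf, hhv, hhf, zero_lie, lie_add, lie_neg, lie_smul,
      hI _ hpf v hv]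
    module
  have hev' : ⁅e, v'⁆ = 0 := by
    have h1 : ⁅e + p, f⁆ = h + ⁅p, f⁆ := by rw [add_lie, hef]
    have h2 := lie_self ⁅e + p, f⁆
    nth_rw 1 [h1] at h2
    rw [leibniz_lie, hhe', hhf', smul_lie, lie_add, lie_neg, lie_smul,
      add_lie _ _ v', hI p hp v' hv'] at h2
    rw [← h2]; module
  have hv0 : v' = 0 := by
    have := t.symm.eq_zero_of_e_f_eq_zero (n := 1) (w := ⟨v', hv'⟩)
      (Subtype.ext (by simp [hhv']; norm_num)) (Subtype.ext (by simp [hev']))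
    exact congrArg Subtype.val this
  refine ⟨h + ⁅p, f⁆, e + p, f, ?_, by rw [add_lie, hef], ?_, ?_⟩
  · intro hz
    refine h0 ?_
    have : h₀ = -(h - h₀) - ⁅p, f⁆ + (h + ⁅p, f⁆) := by abel
    rw [this, hz, add_zero]
    exact sub_mem (neg_mem hh) hpf
  · rw [hhe', ← Nat.cast_smul_eq_nsmul K]; norm_num
  · rw [hhf', hv0, add_zero, ← Nat.cast_smul_eq_nsmul K]; norm_num
end Lift

section Existence
open LieAlgebra

theorem exists_isSl2Triple_of_isKilling {K L : Type*} [Field K] [IsAlgClosed K] [CharZero K]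
    [LieRing L] [LieAlgebra K L] [FiniteDimensional K L] [IsKilling K L] (hL : ¬ IsSolvable L) :
    ∃ h e f : L, IsSl2Triple h e f := by
  obtain ⟨x, hx⟩ := exists_isCartanSubalgebra_engel K L
  let H := LieSubalgebra.engel K x
  by_cases hw : ∃ α : LieModule.Weight K H L, α.IsNonZero
  · obtain ⟨α, hα⟩ := hw
    obtain ⟨h, e, f, t, -⟩ := IsKilling.exists_isSl2Triple_of_weight_isNonZero hα
    exact ⟨h, e, f, t⟩
  · refine absurd ?_ hL
    have htop := cartan_sup_iSup_rootSpace_eq_top H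
    have : (⨆ α : LieModule.Weight K H L, ⨆ (_ : α.IsNonZero), rootSpace H α) = ⊥ := by
      simp only [iSup_eq_bot]
      exact fun α hα ↦ absurd ⟨α, hα⟩ hw
    rw [this, sup_bot_eq] at htop
    refine Function.Surjective.lieAlgebra_isSolvable (f := H.incl) fun y ↦ ⟨⟨y, ?_⟩, rfl⟩
    have : y ∈ H.toLieSubmodule := htop ▸ LieSubmodule.mem_top y
    simpa using this

/-- The projection onto the quotient by an ideal, as a morphism of Lie algebras. -/
def lieQuotientHom {K L : Type*} [CommRing K] [LieRing L] [LieAlgebra K L] (I : LieIdeal K L) :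
    L →ₗ⁅K⁆ L ⧸ I where
  toLinearMap := (LieSubmodule.Quotient.mk' I : L →ₗ[K] L ⧸ I)
  map_lie' {x y} := LieSubmodule.Quotient.mk_bracket (I := I) x y

theorem lieQuotientHom_eq_zero_iff {K L : Type*} [CommRing K] [LieRing L] [LieAlgebra K L]
    {I : LieIdeal K L} {x : L} : lieQuotientHom I x = 0 ↔ x ∈ I :=
  LieSubmodule.Quotient.mk_eq_zero I

theorem lieQuotientHom_surjective {K L : Type*} [CommRing K] [LieRing L] [LieAlgebra K L]
    (I : LieIdeal K L) : Function.Surjective (lieQuotientHom I) :=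
  LieSubmodule.Quotient.surjective_mk' I

theorem isSolvable_of_isSolvable_quotient {K L : Type*} [Field K] [LieRing L] [LieAlgebra K L]
    (I : LieIdeal K L) [IsLieAbelian I] [IsSolvable (L ⧸ I)] : IsSolvable L := by
  obtain ⟨k, hk⟩ := IsSolvable.solvable K (L ⧸ I)
  have h1 : derivedSeries K L k ≤ I := fun x hx ↦ by
    have := LieIdeal.derivedSeries_map_le (f := lieQuotientHom I) k (LieIdeal.mem_map hx)
    rw [hk] at this
    exact lieQuotientHom_eq_zero_iff.1 this
  refine IsSolvable.mk (R := K) (k := 1 + k) ?_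
  rw [derivedSeries_def, derivedSeriesOfIdeal_add, eq_bot_iff]
  refine (derivedSeriesOfIdeal_mono h1 1).trans_eq ?_
  exact (abelian_iff_derived_one_eq_bot I).1 inferInstance

theorem exists_isSl2Triple_of_not_isSolvable (K : Type*) [Field K] [IsAlgClosed K] [CharZero K]
    (n : ℕ) (L : Type*) [LieRing L] [LieAlgebra K L] [FiniteDimensional K L]
    (hn : Module.finrank K L = n) (hL : ¬ IsSolvable L) : ∃ h e f : L, IsSl2Triple h e f := by
  induction n using Nat.strong_induction_on generalizing L with
  | h n ih =>
    by_cases hrad : HasTrivialRadical K L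
    · exact exists_isSl2Triple_of_isKilling (K := K) hL
    · rw [hasTrivialRadical_iff_no_abelian_ideals] at hrad
      push Not at hrad
      obtain ⟨I, hI, hI0⟩ := hrad
      have hpos : 0 < Module.finrank K I := by
        rw [Module.finrank_pos_iff]
        exact (LieSubmodule.nontrivial_iff_ne_bot K L L).2 hI0
      have hfin : Module.finrank K (L ⧸ I) + Module.finrank K I = n :=
        hn ▸ Submodule.finrank_quotient_add_finrank I.toSubmodule
      obtain ⟨h, e, f, t⟩ := ih _ (by omega) (L ⧸ I) rfl
        fun _ ↦ hL (isSolvable_of_isSolvable_quotient I)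
      obtain ⟨h, rfl⟩ := lieQuotientHom_surjective I h
      obtain ⟨e, rfl⟩ := lieQuotientHom_surjective I e
      obtain ⟨f, rfl⟩ := lieQuotientHom_surjective I f
      have hIab : ∀ x ∈ I, ∀ y ∈ I, ⁅x, y⁆ = 0 := fun x hx y hy ↦
        congrArg Subtype.val (trivial_lie_zero I I ⟨x, hx⟩ ⟨y, hy⟩)
      refine exists_isSl2Triple_of_sl2_modulo (K := K) hIab (h₀ := h) (e₀ := e) (f₀ := f) ?_ ?_ ?_ ?_
      · exact fun hh ↦ t.h_ne_zero (lieQuotientHom_eq_zero_iff.2 hh)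
      · rw [← lieQuotientHom_eq_zero_iff, map_sub, LieHom.map_lie, map_smul, t.lie_h_e_smul K,
          sub_self]
      · rw [← lieQuotientHom_eq_zero_iff, map_add, LieHom.map_lie, map_smul, t.lie_lie_smul_f K,
          neg_add_cancel]
      · rw [← lieQuotientHom_eq_zero_iff, map_sub, LieHom.map_lie, t.lie_e_f, sub_self]
end Existence

section LeftSymmetric
variable {K V : Type*} [Field K] [AddCommGroup V] [Module K V] {mul : V →ₗ[K] V →ₗ[K] V}

/-- The left-symmetric identity over an arbitrary field. -/
def IsLeftSymmetric (mul : V →ₗ[K] V →ₗ[K] V) : Prop :=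
  ∀ x y z, mul (mul x y) z - mul x (mul y z) = mul (mul y x) z - mul y (mul x z)

theorem IsLeftSymmetric.flip_mul (hl : IsLeftSymmetric mul) (x y : V) :
    mul.flip (mul y x) = mul.flip x * mul.flip y + (mul y * mul.flip x - mul.flip x * mul y) := by
  ext w
  have := hl y w x
  simp only [LinearMap.flip_apply, LinearMap.add_apply, LinearMap.sub_apply,
    Module.End.mul_apply]
  rw [sub_eq_sub_iff_add_eq_add] at this
  rw [← sub_eq_zero, ← sub_eq_zero.2 this]
  abel

theorem IsLeftSymmetric.trace_pow_mul (hl : IsLeftSymmetric mul) (a : V) (k : ℕ) (y : V) :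
    LinearMap.trace K V (mul.flip a ^ k * mul.flip y) =
      LinearMap.trace K V (mul.flip ((mul.flip a ^ k) y)) := by
  induction k generalizing y with
  | zero => simp
  | succ k ih =>
    rw [pow_succ (mul.flip a) k, Module.End.mul_apply, ← ih, LinearMap.flip_apply mul,
      hl.flip_mul, mul_add, mul_sub, map_add, map_sub, ← mul_assoc _ (mul y),
      LinearMap.trace_mul_comm K (_ * mul y), ← mul_assoc, ← mul_assoc, ← mul_assoc,
      ← pow_succ, ← pow_succ', sub_self, add_zero]

theorem IsLeftSymmetric.isNilpotent_flip [CharZero K] [FiniteDimensional K V]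
    (hl : IsLeftSymmetric mul) (h0 : ∀ x, LinearMap.trace K V (mul.flip x) = 0) (a : V) :
    IsNilpotent (mul.flip a) :=
  isNilpotent_of_forall_trace_pow_eq_zero _ fun k ↦ by rw [pow_succ, hl.trace_pow_mul, h0]

/-- The affine action of a left-symmetric algebra on itself, extended linearly to `V × K`. -/
def affineAction (mul : V →ₗ[K] V →ₗ[K] V) : V →ₗ[K] Module.End K (V × K) where
  toFun a := LinearMap.inl K V K ∘ₗ (mul a).coprod (LinearMap.toSpanSingleton K V a)
  map_add' a b := by ext <;> simp
  map_smul' c a := by ext <;> simp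

theorem affineAction_apply (a : V) (p : V × K) :
    affineAction mul a p = (mul a p.1 + p.2 • a, 0) := rfl

theorem IsLeftSymmetric.affineAction_sub (hl : IsLeftSymmetric mul) (a b : V) :
    affineAction mul (mul a b - mul b a) =
      affineAction mul a * affineAction mul b - affineAction mul b * affineAction mul a := by
  refine LinearMap.ext fun p ↦ Prod.ext ?_ (by simp [affineAction_apply])
  have := hl a b p.1
  simp only [affineAction_apply, Module.End.mul_apply, LinearMap.sub_apply, map_sub, map_add,
    map_smul, zero_smul, add_zero, Prod.fst_sub]
  rw [sub_eq_sub_iff_add_eq_add] at this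
  rw [← sub_eq_zero, ← sub_eq_zero.2 this]
  abel

/-- A complete left-symmetric algebra over an algebraically closed field of characteristic zero
has a solvable underlying Lie algebra. -/
theorem IsLeftSymmetric.isSolvable_of_isAlgClosed [IsAlgClosed K] [CharZero K] {L : Type*}
    [LieRing L] [LieAlgebra K L] [FiniteDimensional K L] {mul : L →ₗ[K] L →ₗ[K] L}
    (hl : IsLeftSymmetric mul) (hbr : ∀ x y, ⁅x, y⁆ = mul x y - mul y x)
    (h0 : ∀ x, LinearMap.trace K L (mul.flip x) = 0) : LieAlgebra.IsSolvable L := by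
  by_contra hL
  obtain ⟨h, e, f, t⟩ := exists_isSl2Triple_of_not_isSolvable K _ L rfl hL
  have haff (a b : L) : affineAction mul a * affineAction mul b -
      affineAction mul b * affineAction mul a = affineAction mul ⁅a, b⁆ := by
    rw [hbr, hl.affineAction_sub]
  have t' : Sl2Rel (affineAction mul h) (affineAction mul e) (affineAction mul f) :=
    { lie_h_e := by rw [haff, t.lie_h_e_smul K, map_smul]
      lie_h_f := by rw [haff, t.lie_lie_smul_f K, map_neg, map_smul]
      lie_e_f := by rw [haff, t.lie_e_f] }
  obtain ⟨v, p, hv, hvp⟩ := t'.exists_eq_add 0 ((0, 1) : L × K)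
  have hv2 : v.2 = 1 := by
    have := congrArg Prod.snd hvp
    simpa [affineAction_apply] using this.symm
  have hv1 : mul.flip v.1 h = - h := by
    have := congrArg Prod.fst hv
    rw [zero_smul, affineAction_apply, hv2, one_smul] at this
    exact eq_neg_of_add_eq_zero_left this
  obtain ⟨N, hN⟩ := hl.isNilpotent_flip h0 v.1
  refine t.h_ne_zero ?_
  have key (k : ℕ) : (mul.flip v.1 ^ k) h = (-1 : K) ^ k • h := by
    induction k with
    | zero => simp
    | succ k ih => rw [pow_succ, Module.End.mul_apply, hv1, map_neg, ih, pow_succ]; module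
  have := key N
  rw [hN, LinearMap.zero_apply, eq_comm, smul_eq_zero] at this
  exact this.resolve_left (pow_ne_zero _ (neg_ne_zero.2 one_ne_zero))
end LeftSymmetric

section BaseChange
open TensorProduct
variable {K V : Type*} [Field K] [AddCommGroup V] [Module K V] {mul : V →ₗ[K] V →ₗ[K] V}

theorem IsLeftSymmetric.baseChange (hl : IsLeftSymmetric mul) (F : Type*) [Field F] [Algebra K F] :
    IsLeftSymmetric (LinearMap.BilinMap.baseChange F mul) := by
  intro x y z
  induction x with
  | zero => simp
  | add x x' hx hx' =>
    simp only [map_add, LinearMap.add_apply, add_sub_add_comm, hx, hx']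
  | tmul a x =>
    induction y with
    | zero => simp
    | add y y' hy hy' =>
      simp only [map_add, LinearMap.add_apply, add_sub_add_comm, hy, hy']
    | tmul b y =>
      induction z with
      | zero => simp
      | add z z' hz hz' => simp only [map_add, add_sub_add_comm, hz, hz']
      | tmul c z =>
        simp only [LinearMap.BilinMap.baseChange_tmul, mul_comm b a, mul_left_comm b a c, mul_assoc,
          ← tmul_sub, hl x y z]

theorem trace_flip_baseChange [FiniteDimensional K V]
    (h0 : ∀ x, LinearMap.trace K V (mul.flip x) = 0) (F : Type*) [Field F] [Algebra K F]
    (x : F ⊗[K] V) :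
    LinearMap.trace F (F ⊗[K] V) ((LinearMap.BilinMap.baseChange F mul).flip x) = 0 := by
  induction x with
  | zero => simp
  | add x y hx hy => rw [map_add, map_add, hx, hy, add_zero]
  | tmul a x =>
    have : (LinearMap.BilinMap.baseChange F mul).flip (a ⊗ₜ x) =
        a • (mul.flip x).baseChange F := by
      ext y
      simp [smul_tmul']
    rw [this, map_smul, LinearMap.trace_baseChange, h0, map_zero, smul_zero]

/-- A complete left-symmetric algebra over a field of characteristic zero has a solvable
underlying Lie algebra. -/
theorem IsLeftSymmetric.isSolvable [CharZero K] {L : Type*}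
    [LieRing L] [LieAlgebra K L] [FiniteDimensional K L] {mul : L →ₗ[K] L →ₗ[K] L}
    (hl : IsLeftSymmetric mul) (hbr : ∀ x y, ⁅x, y⁆ = mul x y - mul y x)
    (h0 : ∀ x, LinearMap.trace K L (mul.flip x) = 0) : LieAlgebra.IsSolvable L := by
  let F := AlgebraicClosure K
  have : CharZero F := algebraRat.charZero F
  rw [← LieAlgebra.isSolvable_tensorProduct_iff (R := K) (L := L) (A := F)]
  refine (hl.baseChange F).isSolvable_of_isAlgClosed (fun x y ↦ ?_) (trace_flip_baseChange h0 F)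
  induction x with
  | zero => simp
  | add x x' hx hx' => simp only [map_add, LinearMap.add_apply, add_sub_add_comm, hx, hx', add_lie]
  | tmul a x =>
    induction y with
    | zero => simp
    | add y y' hy hy' =>
      simp only [map_add, LinearMap.add_apply, add_sub_add_comm, hy, hy', lie_add]
    | tmul b y =>
      rw [LieAlgebra.ExtendScalars.bracket_tmul, hbr, LinearMap.BilinMap.baseChange_tmul,
        LinearMap.BilinMap.baseChange_tmul, mul_comm b a, tmul_sub]

/-- The Lie ring underlying a left-symmetric algebra. -/
abbrev IsLeftSymmetric.lieRing (hl : IsLeftSymmetric mul) : LieRing V where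
  bracket x y := mul x y - mul y x
  add_lie x y z := by
    change mul (x + y) z - mul z (x + y) = mul x z - mul z x + (mul y z - mul z y)
    rw [map_add, map_add, LinearMap.add_apply]; abel
  lie_add x y z := by
    change mul x (y + z) - mul (y + z) x = mul x y - mul y x + (mul x z - mul z x)
    rw [map_add, map_add, LinearMap.add_apply]; abel
  lie_self x := sub_self _
  leibniz_lie x y z := by
    change mul x (mul y z - mul z y) - mul (mul y z - mul z y) x =
      mul (mul x y - mul y x) z - mul z (mul x y - mul y x) +
        (mul y (mul x z - mul z x) - mul (mul x z - mul z x) y)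
    have h1 := hl x y z
    have h2 := hl y z x
    have h3 := hl z x y
    simp only [map_sub, LinearMap.sub_apply]
    rw [sub_eq_sub_iff_add_eq_add] at h1 h2 h3
    rw [← sub_eq_zero] at h1 h2 h3 ⊢
    have h := congrArg₂ (· + ·) (congrArg₂ (· + ·) h1 h2) h3
    simp only [add_zero] at h
    rw [← neg_eq_zero, ← h]
    abel

/-- The Lie algebra underlying a left-symmetric algebra. -/
abbrev IsLeftSymmetric.lieAlgebra (hl : IsLeftSymmetric mul) :
    letI := hl.lieRing
    LieAlgebra K V :=
  letI := hl.lieRing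
  { lie_smul c x y := by
      change mul x (c • y) - mul (c • y) x = c • (mul x y - mul y x)
      rw [map_smul, map_smul, LinearMap.smul_apply, smul_sub] }

end BaseChange

section Reduction
variable {K V : Type*} [Field K] [AddCommGroup V] [Module K V]

theorem LinearMap.det_one_add_of_isNilpotent [FiniteDimensional K V] {n : Module.End K V}
    (hn : IsNilpotent n) : LinearMap.det (1 + n) = 1 := by
  have h := LinearMap.eval_charpoly (-n) 1
  rw [hn.neg.charpoly_eq_X_pow_finrank] at h
  simpa using h.symm

/-- The projection along `r` onto the kernel of `s`, provided that `s r = 1`. -/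
def kerProj (s : V →ₗ[K] K) (r : V) : Module.End K V := 1 - s.smulRight r

theorem kerProj_apply (s : V →ₗ[K] K) (r x : V) : kerProj s r x = x - s x • r := rfl

theorem kerProj_apply_of_eq_zero {s : V →ₗ[K] K} {x : V} (hx : s x = 0) (r : V) :
    kerProj s r x = x := by
  simp [kerProj_apply, hx]

/-- The compression of a bilinear product to the kernel of `s` along `r`, extended by zero to
the line spanned by `r`. -/
def compression (mul : V →ₗ[K] V →ₗ[K] V) (s : V →ₗ[K] K) (r : V) : V →ₗ[K] V →ₗ[K] V :=
  (mul.compl₁₂ (kerProj s r) (kerProj s r)).compr₂ (kerProj s r)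

theorem compression_apply (mul : V →ₗ[K] V →ₗ[K] V) (s : V →ₗ[K] K) (r x y : V) :
    compression mul s r x y = kerProj s r (mul (kerProj s r x) (kerProj s r y)) := rfl

variable (mul : V →ₗ[K] V →ₗ[K] V)

/-- A left-symmetric algebra whose right multiplications have trace `s`, with `s (x ∗ y)` symmetric,
and with an idempotent `r` satisfying `x ∗ r = s x • r`. -/
structure IsReducible (s : V →ₗ[K] K) (r : V) : Prop where
  leftSymm : IsLeftSymmetric mul
  trace_flip : ∀ x, LinearMap.trace K V (mul.flip x) = s x
  apply_mul_comm : ∀ x y, s (mul x y) = s (mul y x)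
  mul_right : ∀ x, mul x r = s x • r
  apply_self : s r = 1

namespace IsReducible
variable {mul} {s : V →ₗ[K] K} {r : V} (h : IsReducible mul s r)
include h

theorem apply_kerProj (x : V) : s (kerProj s r x) = 0 := by
  simp [kerProj_apply, h.apply_self]

theorem kerProj_self : kerProj s r r = 0 := by
  simp [kerProj_apply, h.apply_self]

theorem kerProj_kerProj (x : V) : kerProj s r (kerProj s r x) = kerProj s r x :=
  kerProj_apply_of_eq_zero (h.apply_kerProj x) r

theorem apply_compression (x y : V) : s (compression mul s r x y) = 0 := h.apply_kerProj _

omit h in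
theorem compression_of_apply_eq_zero {x y : V} (hx : s x = 0) (hy : s y = 0) :
    compression mul s r x y = mul x y - s (mul x y) • r := by
  rw [compression_apply, kerProj_apply_of_eq_zero hx, kerProj_apply_of_eq_zero hy, kerProj_apply]

theorem compression_sub {x y : V} (hx : s x = 0) (hy : s y = 0) :
    compression mul s r x y - compression mul s r y x = mul x y - mul y x := by
  rw [compression_of_apply_eq_zero hx hy, compression_of_apply_eq_zero hy hx,
    h.apply_mul_comm x y]
  abel

theorem isLeftSymmetric_compression : IsLeftSymmetric (compression mul s r) := by
  intro x y z
  have hx0 : mul (kerProj s r x) r = 0 := by rw [h.mul_right, h.apply_kerProj, zero_smul]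
  have hy0 : mul (kerProj s r y) r = 0 := by rw [h.mul_right, h.apply_kerProj, zero_smul]
  simp only [compression_apply, h.kerProj_kerProj]
  generalize kerProj s r x = x at *
  generalize kerProj s r y = y at *
  generalize kerProj s r z = z
  simp only [← map_sub]
  congr 1
  simp only [kerProj_apply, map_sub, map_smul, LinearMap.sub_apply, LinearMap.smul_apply, hx0, hy0,
    smul_zero, sub_zero, h.apply_mul_comm y x]
  rw [sub_right_comm, h.leftSymm x y z, sub_right_comm]

theorem trace_flip_compression [FiniteDimensional K V] (x : V) :
    LinearMap.trace K V ((compression mul s r).flip x) = 0 := by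
  have h1 : (compression mul s r).flip x =
      kerProj s r * (mul.flip (kerProj s r x) * kerProj s r) := rfl
  have h2 : kerProj s r * kerProj s r = kerProj s r := LinearMap.ext h.kerProj_kerProj
  have h3 : mul.flip (kerProj s r x) * s.smulRight r = s.smulRight (mul r (kerProj s r x)) := by
    ext; simp
  rw [h1, LinearMap.trace_mul_comm, mul_assoc, h2]
  nth_rw 2 [kerProj]
  rw [mul_sub, mul_one, map_sub, h3, h.trace_flip, LinearMap.trace_smulRight, h.apply_mul_comm,
    h.mul_right, map_smul, h.apply_kerProj, zero_smul, sub_zero]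

variable [CharZero K] [FiniteDimensional K V]

theorem isNilpotent_flip_compression (x : V) : IsNilpotent ((compression mul s r).flip x) :=
  h.isLeftSymmetric_compression.isNilpotent_flip h.trace_flip_compression x

theorem exists_add_compression_eq (x : V) {c : V} (hc : s c = 0) :
    ∃ y, s y = 0 ∧ y + compression mul s r y x = c := by
  have hu : IsUnit (1 + (compression mul s r).flip x) :=
    (h.isNilpotent_flip_compression x).isUnit_one_add
  obtain ⟨y, hy⟩ := ((Module.End.isUnit_iff _).1 hu).2 c
  have hy' : y + compression mul s r y x = c := hy
  refine ⟨y, ?_, hy'⟩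
  rw [← hc, ← hy', map_add, h.apply_compression, add_zero]

theorem add_compression_injective (x : V) :
    Function.Injective fun y ↦ y + compression mul s r y x := by
  have hu : IsUnit (1 + (compression mul s r).flip x) :=
    (h.isNilpotent_flip_compression x).isUnit_one_add
  exact ((Module.End.isUnit_iff _).1 hu).1

theorem exists_det_eq {b : V} (hb : s b = 0) :
    ∃ κ : K, ∀ u : K, LinearMap.det (1 + mul.flip (b + u • r)) = κ + u := by
  obtain ⟨c, hc0, hc⟩ := h.exists_add_compression_eq b (c := mul r b)
    (by rw [h.apply_mul_comm, h.mul_right, hb, zero_smul, map_zero])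
  refine ⟨1 - s (mul c b), fun u ↦ ?_⟩
  set φ : V →ₗ[K] K := s ∘ₗ mul.flip b ∘ₗ kerProj s r + u • s with hφ
  have hφr : φ r = u := by simp [hφ, h.kerProj_self, h.apply_self]
  have hφc : φ c = s (mul c b) := by simp [hφ, kerProj_apply_of_eq_zero hc0, hc0]
  have hfac : 1 + mul.flip (b + u • r) = (1 + (compression mul s r).flip b) *
      (LinearMap.transvection (φ - φ c • s) r * LinearMap.transvection s c) := by
    ext y
    have hb' := kerProj_apply_of_eq_zero hb r
    have hr0 : compression mul s r r b = 0 := by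
      rw [compression_apply, h.kerProj_self, map_zero, LinearMap.zero_apply, map_zero]
    rw [← eq_sub_iff_add_eq'] at hc
    have hyb : mul y b = kerProj s r (mul (kerProj s r y) b) + s (mul (kerProj s r y) b) • r +
        s y • mul r b := by
      simp only [kerProj_apply, map_sub, LinearMap.sub_apply, map_smul, LinearMap.smul_apply]
      module
    simp only [Module.End.mul_apply, LinearMap.transvection.apply, LinearMap.add_apply,
      Module.End.one_apply, LinearMap.flip_apply, map_add, map_smul, LinearMap.smul_apply,
      LinearMap.sub_apply, hr0, hc0, hc, h.mul_right, smul_eq_mul, mul_zero, sub_zero, hyb,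
      compression_apply mul s r y, hb']
    simp only [hφ, LinearMap.add_apply, LinearMap.comp_apply, LinearMap.flip_apply,
      LinearMap.smul_apply, smul_eq_mul]
    module
  rw [hfac, map_mul, map_mul, LinearMap.transvection.det, LinearMap.transvection.det,
    LinearMap.det_one_add_of_isNilpotent (h.isNilpotent_flip_compression b), LinearMap.sub_apply,
    LinearMap.smul_apply, hφr, hφc, h.apply_self, hc0]
  simp
  ring

theorem det_add_smul (x : V) (t : K) :
    LinearMap.det (1 + mul.flip (x + t • r)) = LinearMap.det (1 + mul.flip x) + t := by
  obtain ⟨κ, hκ⟩ := h.exists_det_eq (h.apply_kerProj x)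
  have h1 : x = kerProj s r x + s x • r := by rw [kerProj_apply]; abel
  have h2 : x + t • r = kerProj s r x + (s x + t) • r := by rw [kerProj_apply]; module
  rw [h2, hκ]
  conv_rhs => rw [h1, hκ]
  ring

end IsReducible
end Reduction

section Main

theorem IsLeftSymmetric.trace_flip_mul {K V : Type*} [Field K] [AddCommGroup V] [Module K V]
    {mul : V →ₗ[K] V →ₗ[K] V} (hl : IsLeftSymmetric mul) (x y : V) :
    LinearMap.trace K V (mul.flip (mul y x)) = LinearMap.trace K V (mul.flip x * mul.flip y) := by
  rw [hl.flip_mul, map_add, map_sub, LinearMap.trace_mul_comm K (mul y), sub_self, add_zero]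

theorem isReducible_of_ker_eq {K V : Type*} [Field K] [AddCommGroup V] [Module K V]
    [FiniteDimensional K V] {mul : V →ₗ[K] V →ₗ[K] V} (hl : IsLeftSymmetric mul) {s : V →ₗ[K] K}
    (htr : ∀ x, LinearMap.trace K V (mul.flip x) = s x) (hs : s ≠ 0)
    (hnd : ∀ x, (∀ y, s (mul y x) = 0) → x = 0) {r : V} (hr : ∀ x, s (mul x r) = s x)
    (hker : LinearMap.ker s = LinearMap.ker (mul.flip r)) : IsReducible mul s r := by
  have hcomm (x y : V) : s (mul x y) = s (mul y x) := by
    rw [← htr, ← htr, hl.trace_flip_mul, hl.trace_flip_mul, LinearMap.trace_mul_comm]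
  obtain ⟨x₀, hx₀⟩ : ∃ x, s x ≠ 0 := by
    contrapose! hs
    exact LinearMap.ext hs
  obtain ⟨v, hv⟩ : ∃ v, v = (s x₀)⁻¹ • mul x₀ r := ⟨_, rfl⟩
  have hsv : s v = 1 := by rw [hv, map_smul, hr, smul_eq_mul, inv_mul_cancel₀ hx₀]
  have hmul (x : V) : mul x r = s x • v := by
    have hx : x - (s x * (s x₀)⁻¹) • x₀ ∈ LinearMap.ker s := by
      simp [hx₀]
    rw [hker, LinearMap.mem_ker, LinearMap.flip_apply, map_sub, LinearMap.sub_apply, map_smul,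
      LinearMap.smul_apply, sub_eq_zero] at hx
    rw [hx, hv, smul_smul]
  have hsr : s r = 1 := by
    have : mul.flip r = s.smulRight v := LinearMap.ext hmul
    rw [← htr, this, LinearMap.trace_smulRight, hsv]
  have hvr : v = s (mul v v) • r := by
    rw [← sub_eq_zero]
    refine hnd _ fun x ↦ ?_
    have := congrArg s (hl x v r)
    rw [map_sub, map_sub, hr, hr, hcomm v x, sub_right_inj, hmul, hmul, hsv, one_smul, map_smul,
      map_smul, smul_eq_mul] at this
    rw [map_sub, map_sub, map_smul, map_smul, hr, this, smul_eq_mul, mul_comm, sub_self]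
  have hκ : s (mul v v) = 1 := by
    have := congrArg s hvr
    rwa [map_smul, hsv, hsr, smul_eq_mul, mul_one, eq_comm] at this
  rw [hκ, one_smul] at hvr
  exact ⟨hl, htr, hcomm, fun x ↦ by rw [hmul, hvr], hsr⟩

theorem IsReducible.exists_derSeriesLSA_eq_bot {A : Type*} [AddCommGroup A] [Module ℝ A]
    [FiniteDimensional ℝ A] {mul : A →ₗ[ℝ] A →ₗ[ℝ] A} {s : A →ₗ[ℝ] ℝ} {r : A}
    (h : IsReducible mul s r) : ∃ k, derSeriesLSA mul k = ⊥ := by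
  let hc := h.isLeftSymmetric_compression
  let := hc.lieRing
  let := hc.lieAlgebra
  have hbr (x y : A) : ⁅x, y⁆ = compression mul s r x y - compression mul s r y x := rfl
  have hsolv : LieAlgebra.IsSolvable A := hc.isSolvable hbr h.trace_flip_compression
  obtain ⟨k, hk⟩ := LieAlgebra.IsSolvable.solvable ℝ A
  have hker (k : ℕ) : derSeriesLSA mul (k + 1) ≤ LinearMap.ker s := by
    refine Submodule.span_le.2 ?_
    rintro _ ⟨x, -, y, -, rfl⟩
    rw [SetLike.mem_coe, LinearMap.mem_ker, map_sub, h.apply_mul_comm, sub_self]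
  have hle (k : ℕ) : derSeriesLSA mul (k + 1) ≤ (LieAlgebra.derivedSeries ℝ A k).toSubmodule := by
    induction k with
    | zero => exact le_top
    | succ k ih =>
      refine Submodule.span_le.2 ?_
      rintro _ ⟨x, hx, y, hy, rfl⟩
      rw [← h.compression_sub (hker k hx) (hker k hy), ← hbr, LieAlgebra.derivedSeries_def,
        LieAlgebra.derivedSeriesOfIdeal_succ]
      exact LieSubmodule.lie_mem_lie (ih hx) (ih hy)
  refine ⟨k + 1, eq_bot_iff.2 ((hle k).trans ?_)⟩
  rw [hk, LieSubmodule.bot_toSubmodule]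

end Main

theorem stmt16 (A : Type*) [AddCommGroup A] [Module ℝ A] [FiniteDimensional ℝ A]
    (mul : A →ₗ[ℝ] A →ₗ[ℝ] A) (hlsa : IsLSA mul)
    (hincomplete : ∃ x : A, LinearMap.trace ℝ A (mul.flip x) ≠ 0)
    (τ : A → A → ℝ)
    (hτ : ∀ x y, τ x y = LinearMap.trace ℝ A (mul.flip x ∘ₗ mul.flip y))
    (hnd : ∀ x, (∀ y, τ x y = 0) → x = 0)
    (r : A) (hr : ∀ x, τ r x = LinearMap.trace ℝ A (mul.flip x))
    (hker : kerTrR mul = LinearMap.ker (mul.flip r))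
    (P : A → ℝ)
    (hP : ∀ x, P x = LinearMap.det (LinearMap.id + mul.flip x)) :
    -- (i) ∘ maps B × B to B, makes B an LSA, and (B, ∘) is complete
    ∃ hB : ∀ x ∈ kerTrR mul, ∀ y ∈ kerTrR mul, cmul mul τ r x y ∈ kerTrR mul,
      (∀ x ∈ kerTrR mul, ∀ y ∈ kerTrR mul, ∀ z ∈ kerTrR mul,
        cmul mul τ r (cmul mul τ r x y) z - cmul mul τ r x (cmul mul τ r y z) =
          cmul mul τ r (cmul mul τ r y x) z - cmul mul τ r y (cmul mul τ r x z)) ∧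
      (∀ x : A, ∀ hx : x ∈ kerTrR mul,
        Function.Bijective (fun y : ↥(kerTrR mul) =>
          (⟨(y : A) + cmul mul τ r (y : A) x,
            (kerTrR mul).add_mem y.2 (hB (y : A) y.2 x hx)⟩ : ↥(kerTrR mul)))) ∧
      -- (ii) the underlying Lie algebra of (A, ∗) is solvable
      (∃ k : ℕ, derSeriesLSA mul k = ⊥) ∧
      -- (iii) P(x + t·r) = P(x) + t
      (∀ (x : A) (t : ℝ), P (x + t • r) = P x + t) := by
  set s : A →ₗ[ℝ] ℝ := LinearMap.trace ℝ A ∘ₗ mul.flip with hs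
  have hl : IsLeftSymmetric mul := hlsa
  have hτs (x y : A) : τ x y = s (mul y x) := by
    rw [hτ]
    exact (hl.trace_flip_mul x y).symm
  have h : IsReducible mul s r := by
    refine isReducible_of_ker_eq hl (fun _ ↦ rfl) (fun hs0 ↦ ?_) (fun x hx ↦ hnd x fun y ↦ ?_)
      (fun x ↦ ?_) hker
    · obtain ⟨x, hx⟩ := hincomplete
      exact hx (LinearMap.congr_fun hs0 x)
    · rw [hτs, hx]
    · rw [← hτs, hr]
      rfl
  have hcmul : ∀ x ∈ kerTrR mul, ∀ y ∈ kerTrR mul,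
      cmul mul τ r x y = compression mul s r x y := fun x hx y hy ↦ by
    rw [cmul, hτs, h.apply_mul_comm, IsReducible.compression_of_apply_eq_zero hx hy]
  have hmem (x y : A) : compression mul s r x y ∈ kerTrR mul := h.apply_compression x y
  refine ⟨fun x hx y hy ↦ by rw [hcmul x hx y hy]; exact hmem x y, fun x hx y hy z hz ↦ ?_,
    fun x hx ↦ ⟨fun y z hyz ↦ ?_, fun c ↦ ?_⟩, h.exists_derSeriesLSA_eq_bot, fun x t ↦ ?_⟩
  · rw [hcmul x hx y hy, hcmul y hy x hx, hcmul y hy z hz, hcmul x hx z hz,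
      hcmul _ (hmem x y) z hz, hcmul _ (hmem y x) z hz, hcmul x hx _ (hmem y z),
      hcmul y hy _ (hmem x z)]
    exact h.isLeftSymmetric_compression x y z
  · have hyz' := congrArg Subtype.val hyz
    simp only [hcmul _ y.2 x hx, hcmul _ z.2 x hx] at hyz'
    exact Subtype.ext (h.add_compression_injective x hyz')
  · obtain ⟨y, hy, hyc⟩ := h.exists_add_compression_eq x c.2
    refine ⟨⟨y, hy⟩, Subtype.ext ?_⟩
    change y + cmul mul τ r y x = c
    rw [hcmul y hy x hx, hyc]
  · rw [hP, hP]
    exact h.det_add_smul x t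
end
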